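/- arXiv:1502.06513 — 3 statements merged into one kernel-verified Lean document; each statement's English description precedes it below -/
import Mathlib

section
/- Let n ≥ 2, let A, B ⊆ ℝⁿ be compact sets satisfying A = A^♮ and B = B^♮, let 0 < τ ≤ 1/2, t ∈ [τ, 1 − τ], and set S := tA + (1 − t)B. Assume that A and B are (M, τ)-normalized, i.e. H^{n−1}(π(A)) + H^{n−1}(π(B)) + sup_y H¹(A_y) + sup_y H¹(B_y) ≤ M/τ^{2n} where M is the dimensional constant from the normalization lemma, and that ||A| − 1| + ||B| − 1| + ||S| − 1| ≤ δ. Set β_{n,τ} := τ/(16(n−1)|log τ|). Then there exists a constant N_n > 1 depending only on n such that, provided δ ≤ e^{−τ^{−N_n}}, there are a vector v ∈ ℝⁿ and a convex set K ⊆ ℝⁿ with A ∪ (B + v) ⊆ K, |A Δ (B + v)| ≤ τ^{−N_n} δ^{β_{n,τ}/(8n)}, and |K \ A| + |K \ (B + v)| ≤ τ^{−N_n} δ^{β_{n,τ}/(8n³)}. -/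
open MeasureTheory Set Pointwise
open scoped ENNReal

/-- Vertical slice `E(s) = {y : (y, s) ∈ E}` of a set `E ⊆ ℝ^{k} × ℝ`. -/
def vslice {k : ℕ} (E : Set (EuclideanSpace ℝ (Fin k) × ℝ)) (s : ℝ) :
    Set (EuclideanSpace ℝ (Fin k)) := {y | (y, s) ∈ E}

/-- Fiber `E_y = {s : (y, s) ∈ E}` of a set `E ⊆ ℝ^{k} × ℝ`. -/
def hfiber {k : ℕ} (E : Set (EuclideanSpace ℝ (Fin k) × ℝ))
    (y : EuclideanSpace ℝ (Fin k)) : Set ℝ := {s | (y, s) ∈ E}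

/-- Radius of the closed Euclidean ball in `ℝ^k` whose volume is `v`. -/
noncomputable def diskRadius (k : ℕ) (v : ℝ≥0∞) : ℝ :=
  ((v / volume (Metric.closedBall (0 : EuclideanSpace ℝ (Fin k)) 1)).toReal) ^ ((1 : ℝ) / k)

/-- Schwarz symmetrization `E^∗`. -/
noncomputable def schwarzSymm {k : ℕ} (E : Set (EuclideanSpace ℝ (Fin k) × ℝ)) :
    Set (EuclideanSpace ℝ (Fin k) × ℝ) :=
  {p | 0 < volume (vslice E p.2) ∧
      p.1 ∈ Metric.closedBall 0 (diskRadius k (volume (vslice E p.2)))}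

/-- Steiner symmetrization `E^⋆`. -/
noncomputable def steinerSymm {k : ℕ} (E : Set (EuclideanSpace ℝ (Fin k) × ℝ)) :
    Set (EuclideanSpace ℝ (Fin k) × ℝ) :=
  {p | 0 < volume (hfiber E p.1) ∧
      p.2 ∈ Set.Icc (-((volume (hfiber E p.1)).toReal / 2))
        ((volume (hfiber E p.1)).toReal / 2)}

/-- `E^♮ = (E^⋆)^∗`. -/
noncomputable def natSymm {k : ℕ} (E : Set (EuclideanSpace ℝ (Fin k) × ℝ)) :
    Set (EuclideanSpace ℝ (Fin k) × ℝ) :=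
  schwarzSymm (steinerSymm E)


/-- Down-closed (rotation and reflection invariant, decreasing profile) sets. -/
def DownSet {k : ℕ} (X : Set (EuclideanSpace ℝ (Fin k) × ℝ)) : Prop :=
  ∀ p ∈ X, ∀ q : EuclideanSpace ℝ (Fin k) × ℝ, ‖q.1‖ ≤ ‖p.1‖ → |q.2| ≤ |p.2| → q ∈ X

theorem volHaar (k : ℕ) :
    (volume : Measure (EuclideanSpace ℝ (Fin k) × ℝ)).IsAddHaarMeasure := by
  rw [Measure.volume_eq_prod]; infer_instance

theorem finrankProd (k : ℕ) : Module.finrank ℝ (EuclideanSpace ℝ (Fin k) × ℝ) = k + 1 := by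
  simp

theorem diskRadius_mono {k : ℕ} (hk : 1 ≤ k) {v w : ℝ≥0∞} (h : v ≤ w) (hw : w ≠ ⊤) :
    diskRadius k v ≤ diskRadius k w := by
  unfold diskRadius
  apply Real.rpow_le_rpow ENNReal.toReal_nonneg
  · apply ENNReal.toReal_mono
    · apply ENNReal.div_ne_top hw
      exact (Metric.measure_closedBall_pos volume _ one_pos).ne'
    · gcongr
  · positivity

theorem down_natSymm {k : ℕ} (hk : 1 ≤ k) {A : Set (EuclideanSpace ℝ (Fin k) × ℝ)}
    (hA : IsCompact A) (h : A = natSymm A) : DownSet A := by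
  have hfin : ∀ s, volume (vslice (steinerSymm A) s) ≠ ⊤ := by
    intro s
    have hsub : vslice (steinerSymm A) s ⊆ Prod.fst '' A := by
      intro y hy
      have h1 : 0 < volume (hfiber A y) := hy.1
      obtain ⟨σ, hσ⟩ := nonempty_of_measure_ne_zero h1.ne'
      exact ⟨(y, σ), hσ, rfl⟩
    exact ((measure_mono hsub).trans_lt (hA.image continuous_fst).measure_lt_top).ne
  have hmono : ∀ s s' : ℝ, |s'| ≤ |s| →
      vslice (steinerSymm A) s ⊆ vslice (steinerSymm A) s' := by
    intro s s' hs y hy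
    refine ⟨hy.1, ?_⟩
    have h2 := hy.2
    simp only [mem_Icc, ← abs_le] at h2 ⊢
    exact hs.trans h2
  intro p hp q hq1 hq2
  rw [h] at hp ⊢
  obtain ⟨hp1, hp2⟩ := hp
  have hm := measure_mono (μ := volume) (hmono _ _ hq2)
  refine ⟨hp1.trans_le hm, ?_⟩
  simp only [Metric.mem_closedBall, dist_zero_right] at hp2 ⊢
  exact hq1.trans (hp2.trans (diskRadius_mono hk hm (hfin _)))

theorem lintegral_smul {k : ℕ} {l : ℝ} (hl : 0 < l) {f : EuclideanSpace ℝ (Fin k) → ℝ≥0∞}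
    (hf : Measurable f) :
    ENNReal.ofReal (l ^ k) * ∫⁻ y, f (l • y) = ∫⁻ y, f y := by
  have h1 : ∫⁻ y, f (l • y) = ∫⁻ y, f y ∂(Measure.map (fun x => l • x) volume) := by
    rw [lintegral_map hf (by fun_prop)]
  rw [h1, Measure.map_addHaar_smul _ hl.ne', lintegral_smul_measure]
  rw [finrank_euclideanSpace_fin, smul_eq_mul, ← mul_assoc, ← ENNReal.ofReal_mul (by positivity),
    abs_of_pos (by positivity), mul_inv_cancel₀ (by positivity)]
  simp

/-- Brunn-Minkowski with scaled pairing of fibres. -/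
theorem bm_piece {k : ℕ} {X Y Z : Set (EuclideanSpace ℝ (Fin k) × ℝ)}
    (hX : IsCompact X) (hY : IsCompact Y) (hZ : IsCompact Z) {s s' r r' t : ℝ}
    (hr : 0 < r) (hr' : 0 < r') (ht : 0 < t) (ht1 : t < 1)
    (hX1 : ∀ p ∈ X, s ≤ p.2 ∧ ‖p.1‖ ≤ r) (hX2 : ∀ y, ‖y‖ ≤ r → (y, s) ∈ X)
    (hX3 : ∀ y σ σ', (y, σ) ∈ X → s ≤ σ' → σ' ≤ σ → (y, σ') ∈ X)
    (hY1 : ∀ p ∈ Y, s' ≤ p.2 ∧ ‖p.1‖ ≤ r') (hY2 : ∀ y, ‖y‖ ≤ r' → (y, s') ∈ Y)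
    (hY3 : ∀ y σ σ', (y, σ) ∈ Y → s' ≤ σ' → σ' ≤ σ → (y, σ') ∈ Y)
    (hXYZ : ∀ p ∈ X, ∀ q ∈ Y, t • p + (1 - t) • q ∈ Z) :
    (t + (1 - t) * (r' / r)) ^ k *
      (t * volume.real X + (1 - t) * ((r / r') ^ k * volume.real Y)) ≤ volume.real Z := by
  have h1t : 0 < 1 - t := by linarith
  set c : ℝ := r' / r with hc
  have hc0 : 0 < c := by positivity
  set l : ℝ := t + (1 - t) * c with hl
  have hl0 : 0 < l := by positivity
  have key : ∀ y, ENNReal.ofReal t * volume (Prod.mk y ⁻¹' X) +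
      ENNReal.ofReal (1 - t) * volume (Prod.mk (c • y) ⁻¹' Y) ≤
      volume (Prod.mk (l • y) ⁻¹' Z) := by
    intro y
    have hny : ‖c • y‖ = c * ‖y‖ := by rw [norm_smul, Real.norm_of_nonneg hc0.le]
    by_cases hy : ‖y‖ ≤ r
    · have hy' : ‖c • y‖ ≤ r' := by
        rw [hny, hc, div_mul_eq_mul_div, div_le_iff₀ hr]; gcongr
      have cX : IsCompact (Prod.mk y ⁻¹' X) := by
        have : Prod.mk y ⁻¹' X = Prod.snd '' (X ∩ Prod.fst ⁻¹' {y}) := by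
          ext σ; constructor
          · intro h; exact ⟨(y, σ), ⟨h, rfl⟩, rfl⟩
          · rintro ⟨⟨a, b⟩, ⟨h, rfl⟩, rfl⟩; exact h
        rw [this]
        exact (hX.inter_right (isClosed_singleton.preimage continuous_fst)).image continuous_snd
      have cY : IsCompact (Prod.mk (c • y) ⁻¹' Y) := by
        have : Prod.mk (c • y) ⁻¹' Y = Prod.snd '' (Y ∩ Prod.fst ⁻¹' {c • y}) := by
          ext σ; constructor
          · intro h; exact ⟨(c • y, σ), ⟨h, rfl⟩, rfl⟩
          · rintro ⟨⟨a, b⟩, ⟨h, h2⟩, rfl⟩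
            have h2 : a = c • y := h2
            subst h2; exact h
        rw [this]
        exact (hY.inter_right (isClosed_singleton.preimage continuous_fst)).image continuous_snd
      obtain ⟨m1, hm1, hm1'⟩ := cX.exists_isGreatest ⟨s, hX2 y hy⟩
      obtain ⟨m2, hm2, hm2'⟩ := cY.exists_isGreatest ⟨s', hY2 _ hy'⟩
      have hsm1 : s ≤ m1 := (hX1 _ hm1).1
      have hsm2 : s' ≤ m2 := (hY1 _ hm2).1
      have v1 : volume (Prod.mk y ⁻¹' X) ≤ ENNReal.ofReal (m1 - s) := by
        rw [← Real.volume_Icc]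
        exact measure_mono fun σ hσ => ⟨(hX1 _ hσ).1, hm1' hσ⟩
      have v2 : volume (Prod.mk (c • y) ⁻¹' Y) ≤ ENNReal.ofReal (m2 - s') := by
        rw [← Real.volume_Icc]
        exact measure_mono fun σ hσ => ⟨(hY1 _ hσ).1, hm2' hσ⟩
      have v3 : ENNReal.ofReal (t * (m1 - s) + (1 - t) * (m2 - s')) ≤
          volume (Prod.mk (l • y) ⁻¹' Z) := by
        have e : t * (m1 - s) + (1 - t) * (m2 - s') =
          (t * m1 + (1 - t) * m2) - (t * s + (1 - t) * s') := by ring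
        rw [e, ← Real.volume_Icc]
        apply measure_mono
        intro σ hσ
        have : σ ∈ segment ℝ (t * s + (1 - t) * s') (t * m1 + (1 - t) * m2) := by
          rw [segment_eq_Icc (by nlinarith [mul_le_mul_of_nonneg_left hsm1 ht.le,
            mul_le_mul_of_nonneg_left hsm2 h1t.le])]
          exact hσ
        obtain ⟨a, b, ha, hb, hab, rfl⟩ := this
        have aux : ∀ u v : ℝ, u ≤ v → u ≤ a * u + b * v ∧ a * u + b * v ≤ v := by
          intro u v huv
          obtain rfl : a = 1 - b := by linarith
          constructor <;>
            nlinarith [mul_nonneg hb (sub_nonneg.2 huv), mul_nonneg ha (sub_nonneg.2 huv)]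
        have e1 : (y, a * s + b * m1) ∈ X := hX3 _ _ _ hm1 (aux _ _ hsm1).1 (aux _ _ hsm1).2
        have e2 : (c • y, a * s' + b * m2) ∈ Y := hY3 _ _ _ hm2 (aux _ _ hsm2).1 (aux _ _ hsm2).2
        have := hXYZ _ e1 _ e2
        simp only [mem_preimage]
        convert this using 1
        ext1
        · simp only [Prod.fst_add, Prod.smul_fst, hl, add_smul, smul_smul]
        · simp only [Prod.snd_add, Prod.smul_snd, smul_eq_mul]; ring
      refine le_trans ?_ v3
      rw [ENNReal.ofReal_add (by nlinarith) (by nlinarith), ENNReal.ofReal_mul ht.le,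
        ENNReal.ofReal_mul h1t.le]
      gcongr
    · have e1 : Prod.mk y ⁻¹' X = ∅ := by
        ext σ; simp only [mem_preimage, mem_empty_iff_false, iff_false]
        intro h; exact hy (hX1 _ h).2
      have e2 : Prod.mk (c • y) ⁻¹' Y = ∅ := by
        ext σ; simp only [mem_preimage, mem_empty_iff_false, iff_false]
        intro h
        have := (hY1 _ h).2
        simp only [hny] at this
        rw [hc, div_mul_eq_mul_div, div_le_iff₀ hr] at this
        exact hy (le_of_mul_le_mul_left this hr')
      rw [e1, e2]; simp
  have mX := measurable_measure_prodMk_left (ν := (volume : Measure ℝ)) hX.measurableSet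
  have mY := measurable_measure_prodMk_left (ν := (volume : Measure ℝ)) hY.measurableSet
  have mZ := measurable_measure_prodMk_left (ν := (volume : Measure ℝ)) hZ.measurableSet
  have eX : volume X = ∫⁻ y, volume (Prod.mk y ⁻¹' X) := by
    rw [Measure.volume_eq_prod, Measure.prod_apply hX.measurableSet]
  have eY : volume Y = ∫⁻ y, volume (Prod.mk y ⁻¹' Y) := by
    rw [Measure.volume_eq_prod, Measure.prod_apply hY.measurableSet]
  have eZ : volume Z = ∫⁻ y, volume (Prod.mk y ⁻¹' Z) := by
    rw [Measure.volume_eq_prod, Measure.prod_apply hZ.measurableSet]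
  have main : ENNReal.ofReal (l ^ k) * (ENNReal.ofReal t * volume X +
      ENNReal.ofReal (1 - t) * (ENNReal.ofReal ((r / r') ^ k) * volume Y)) ≤ volume Z := by
    have hY' : ENNReal.ofReal ((r / r') ^ k) * volume Y =
        ∫⁻ y, volume (Prod.mk (c • y) ⁻¹' Y) := by
      rw [eY, ← lintegral_smul hc0 mY, ← mul_assoc, ← ENNReal.ofReal_mul (by positivity),
        ← mul_pow, hc, div_mul_div_cancel₀ hr'.ne', div_self hr.ne']
      simp
    have mY' : Measurable fun y => volume (Prod.mk (c • y) ⁻¹' Y) :=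
      mY.comp (measurable_const_smul c)
    rw [hY', eX, eZ, ← lintegral_smul hl0 mZ, ← lintegral_const_mul _ mX,
      ← lintegral_const_mul _ mY', ← lintegral_add_left (mX.const_mul _)]
    gcongr with y
    exact key y
  have := ENNReal.toReal_mono hZ.measure_lt_top.ne main
  rw [ENNReal.toReal_mul, ENNReal.toReal_add, ENNReal.toReal_mul, ENNReal.toReal_mul,
    ENNReal.toReal_mul, ENNReal.toReal_ofReal (by positivity), ENNReal.toReal_ofReal ht.le,
    ENNReal.toReal_ofReal h1t.le, ENNReal.toReal_ofReal (by positivity)] at this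
  · exact this
  · exact ENNReal.mul_ne_top ENNReal.ofReal_ne_top hX.measure_lt_top.ne
  · exact ENNReal.mul_ne_top ENNReal.ofReal_ne_top
      (ENNReal.mul_ne_top ENNReal.ofReal_ne_top hY.measure_lt_top.ne)

theorem phi_bound {t c : ℝ} (ht : 0 < t) (ht1 : t < 1) (hc : 0 < c) (k : ℕ) (hk : 1 ≤ k) :
    1 + t * (1 - t) * ((1 - c) ^ 2 / c) ≤
      (t + (1 - t) * c) ^ k * (t + (1 - t) * (1 / c) ^ k) := by
  have h1t : 0 < 1 - t := by linarith
  induction k, hk using Nat.le_induction with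
  | base => 
    apply le_of_eq; field_simp; ring
  | succ k hk ih =>
    refine ih.trans ?_
    rw [pow_succ (t + (1 - t) * c), mul_assoc]
    gcongr
    have e : (t + (1 - t) * c) * (t + (1 - t) * (1 / c) ^ (k + 1)) - (t + (1 - t) * (1 / c) ^ k)
      = t * (1 - t) * ((1 - c) * ((1 / c) ^ (k + 1) - 1)) := by
      rw [pow_succ (1 / c)]; field_simp; ring
    have : 0 ≤ (1 - c) * ((1 / c) ^ (k + 1) - 1) := by
      rcases le_total c 1 with h | h
      · apply mul_nonneg (by linarith)
        have : 1 ≤ (1 / c) ^ (k + 1) := one_le_pow₀ (by rw [le_div_iff₀ hc]; linarith)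
        linarith
      · apply mul_nonneg_of_nonpos_of_nonpos (by linarith)
        have : (1 / c) ^ (k + 1) ≤ 1 :=
          pow_le_one₀ (by positivity) (by rw [div_le_iff₀ hc]; linarith)
        linarith
    have h2 := mul_nonneg (mul_pos ht h1t).le this
    linarith

/-- Volume of the unit ball. -/
noncomputable def omegaBall (k : ℕ) : ℝ :=
  volume.real (Metric.closedBall (0 : EuclideanSpace ℝ (Fin k)) 1)

theorem omegaBall_pos (k : ℕ) : 0 < omegaBall k := by
  unfold omegaBall
  exact ENNReal.toReal_pos (Metric.measure_closedBall_pos volume _ one_pos).ne'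
    measure_closedBall_lt_top.ne

theorem ball_real {k : ℕ} (x : EuclideanSpace ℝ (Fin k)) {r : ℝ} (hr : 0 ≤ r) :
    volume.real (Metric.closedBall x r) = r ^ k * omegaBall k := by
  rw [Measure.addHaar_real_closedBall' _ _ hr, finrank_euclideanSpace_fin]; rfl

theorem box_real {k : ℕ} (x : EuclideanSpace ℝ (Fin k)) {r : ℝ} (hr : 0 ≤ r) (I : Set ℝ) :
    volume.real (Metric.closedBall x r ×ˢ I) = r ^ k * omegaBall k * volume.real I := by
  rw [Measure.volume_eq_prod, measureReal_prod_prod, ball_real _ hr]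

theorem box_fin {k : ℕ} (x : EuclideanSpace ℝ (Fin k)) (r : ℝ) (a b : ℝ) :
    volume (Metric.closedBall x r ×ˢ Icc a b) ≠ ⊤ :=
  ((isCompact_closedBall x r).prod isCompact_Icc).measure_lt_top.ne

theorem plane_null {k : ℕ} (v : ℝ) :
    volume {p : EuclideanSpace ℝ (Fin k) × ℝ | p.2 = v} = 0 := by
  have : {p : EuclideanSpace ℝ (Fin k) × ℝ | p.2 = v} = univ ×ˢ {v} := by
    ext p; simp
  rw [this, Measure.volume_eq_prod, Measure.prod_prod]; simp

theorem plane_cut {k : ℕ} (X : Set (EuclideanSpace ℝ (Fin k) × ℝ)) (v : ℝ) :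
    volume (X ∩ {p | v ≤ p.2}) = volume (X ∩ {p | v < p.2}) := by
  apply le_antisymm
  · have : X ∩ {p | v ≤ p.2} ⊆ (X ∩ {p | v < p.2}) ∪ {p | p.2 = v} := by
      rintro p ⟨h1, h2⟩
      rcases eq_or_lt_of_le (show v ≤ p.2 from h2) with h | h
      · right; exact h.symm
      · left; exact ⟨h1, h⟩
    calc _ ≤ _ := measure_mono this
      _ ≤ _ := measure_union_le _ _
      _ = _ := by rw [plane_null]; simp
  · exact measure_mono fun p hp => ⟨hp.1, le_of_lt (show v < p.2 from hp.2)⟩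

theorem half_volume {k : ℕ} {X : Set (EuclideanSpace ℝ (Fin k) × ℝ)} (hX : IsCompact X)
    (hd : DownSet X) : volume.real X = 2 * volume.real (X ∩ {p | 0 ≤ p.2}) := by
  have m0 : MeasurableSet {p : EuclideanSpace ℝ (Fin k) × ℝ | 0 ≤ p.2} :=
    measurableSet_le measurable_const measurable_snd
  have h1 := measure_inter_add_sdiff (μ := volume) X m0
  have h2 : volume (X \ {p | 0 ≤ p.2}) = volume (X ∩ {p | 0 < p.2}) := by
    have mp : MeasurePreserving (Prod.map id Neg.neg :
        EuclideanSpace ℝ (Fin k) × ℝ → EuclideanSpace ℝ (Fin k) × ℝ) volume volume := by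
      rw [Measure.volume_eq_prod]
      exact (MeasurePreserving.id _).prod (Measure.measurePreserving_neg _)
    rw [← mp.measure_preimage (hX.measurableSet.diff m0).nullMeasurableSet]
    congr 1
    ext ⟨y, s⟩
    simp only [mem_preimage, Prod.map, mem_sdiff, mem_ofPred_eq, mem_inter_iff, id]
    constructor
    · rintro ⟨h, h'⟩
      exact ⟨hd _ h _ (le_refl _) (by simp), by linarith⟩
    · rintro ⟨h, h'⟩
      exact ⟨hd _ h _ (le_refl _) (by simp), by linarith⟩
  rw [h2, ← plane_cut] at h1
  have f : volume (X ∩ {p | 0 ≤ p.2}) ≠ ⊤ :=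
    ((measure_mono inter_subset_left).trans_lt hX.measure_lt_top).ne
  unfold Measure.real
  rw [← h1, ENNReal.toReal_add f f]; ring

theorem memS {k : ℕ} {A B : Set (EuclideanSpace ℝ (Fin k) × ℝ)} (hA : DownSet A)
    (hB : DownSet B) {t : ℝ} (ht : 0 < t) (ht1 : t < 1)
    {p q w : EuclideanSpace ℝ (Fin k) × ℝ} (hp : p ∈ A) (hq : q ∈ B)
    (h1 : ‖w.1‖ ≤ t * ‖p.1‖ + (1 - t) * ‖q.1‖) (h2 : |w.2| ≤ t * |p.2| + (1 - t) * |q.2|) :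
    w ∈ t • A + (1 - t) • B := by
  have h1t : 0 < 1 - t := by linarith
  have scal : ∀ a b c : ℝ, 0 ≤ a → 0 ≤ b → 0 ≤ c → c ≤ t * a + (1 - t) * b →
      ∃ x y : ℝ, 0 ≤ x ∧ 0 ≤ y ∧ t * x + (1 - t) * y = 1 ∧ x * c ≤ a ∧ y * c ≤ b := by
    intro a b c ha hb hc h
    rcases eq_or_lt_of_le (show 0 ≤ t * a + (1 - t) * b by positivity) with h0 | h0
    · have : c = 0 := by linarith
      exact ⟨1, 1, zero_le_one, zero_le_one, by ring, by simp [this, ha], by simp [this, hb]⟩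
    · refine ⟨a / (t * a + (1 - t) * b), b / (t * a + (1 - t) * b), by positivity, by positivity,
        by field_simp, ?_, ?_⟩
      · rw [div_mul_eq_mul_div, div_le_iff₀ h0]; gcongr
      · rw [div_mul_eq_mul_div, div_le_iff₀ h0]; gcongr
  obtain ⟨x, y, hx, hy, hxy, hx1, hy1⟩ := scal _ _ _ (norm_nonneg _) (norm_nonneg _) (norm_nonneg _) h1
  obtain ⟨x', y', hx', hy', hxy', hx1', hy1'⟩ := scal _ _ _ (abs_nonneg _) (abs_nonneg _) (abs_nonneg _) h2
  refine Set.mem_add.2 ⟨t • (x • w.1, x' * w.2), Set.smul_mem_smul_set (hA _ hp _ ?_ ?_),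
    (1 - t) • (y • w.1, y' * w.2), Set.smul_mem_smul_set (hB _ hq _ ?_ ?_), ?_⟩
  · simpa [norm_smul, abs_of_nonneg hx] using hx1
  · simpa [abs_mul, abs_of_nonneg hx'] using hx1'
  · simpa [norm_smul, abs_of_nonneg hy] using hy1
  · simpa [abs_mul, abs_of_nonneg hy'] using hy1'
  · ext1
    · simp only [Prod.fst_add, Prod.smul_fst, smul_smul, ← add_smul, hxy, one_smul]
    · simp only [Prod.snd_add, Prod.smul_snd, smul_eq_mul, ← mul_assoc, ← add_mul, hxy', one_mul]

theorem downS {k : ℕ} {A B : Set (EuclideanSpace ℝ (Fin k) × ℝ)} (hA : DownSet A)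
    (hB : DownSet B) {t : ℝ} (ht : 0 < t) (ht1 : t < 1) : DownSet (t • A + (1 - t) • B) := by
  intro w hw w' h1 h2
  obtain ⟨_, ⟨p, hp, rfl⟩, _, ⟨q, hq, rfl⟩, rfl⟩ := Set.mem_add.1 hw
  have h1t : 0 < 1 - t := by linarith
  refine memS hA hB ht ht1 hp hq (h1.trans ?_) (h2.trans ?_)
  · refine (norm_add_le _ _).trans (le_of_eq ?_)
    simp [norm_smul, abs_of_pos ht, abs_of_pos h1t]
  · refine (abs_add_le _ _).trans (le_of_eq ?_)
    simp [abs_mul, abs_of_pos ht, abs_of_pos h1t]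

theorem compact_comb {E : Type*} [NormedAddCommGroup E] [NormedSpace ℝ E] {A B : Set E}
    (hA : IsCompact A) (hB : IsCompact B) (t : ℝ) : IsCompact (t • A + (1 - t) • B) := by
  have h1 : IsCompact (t • A) := hA.image (continuous_const_smul t)
  have h2 : IsCompact ((1 - t) • B) := hB.image (continuous_const_smul (1 - t))
  exact h1.add h2

theorem compactS {k : ℕ} {A B : Set (EuclideanSpace ℝ (Fin k) × ℝ)} (hA : IsCompact A)
    (hB : IsCompact B) (t : ℝ) : IsCompact (t • A + (1 - t) • B) := by
  have := compact_comb hA hB t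
  exact this

theorem exists_rad {k : ℕ} {X : Set (EuclideanSpace ℝ (Fin k) × ℝ)} (hX : IsCompact X)
    (hd : DownSet X) {s : ℝ} (h : ∃ y : EuclideanSpace ℝ (Fin k), (y, s) ∈ X) :
    ∃ r : ℝ, 0 ≤ r ∧ ∀ y : EuclideanSpace ℝ (Fin k), (y, s) ∈ X ↔ ‖y‖ ≤ r := by
  have hc : IsCompact (X ∩ {p | p.2 = s}) :=
    hX.inter_right (isClosed_eq continuous_snd continuous_const)
  obtain ⟨y, hy⟩ := h
  have hcont : ContinuousOn (fun p : EuclideanSpace ℝ (Fin k) × ℝ => ‖p.1‖)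
      (X ∩ {p | p.2 = s}) := continuous_fst.norm.continuousOn
  obtain ⟨p, ⟨hp, hps⟩, hmax⟩ := hc.exists_isMaxOn ⟨(y, s), hy, rfl⟩ hcont
  have hps : p.2 = s := hps
  have hmax' : ∀ q ∈ X ∩ {p | p.2 = s}, ‖q.1‖ ≤ ‖p.1‖ := isMaxOn_iff.1 hmax
  refine ⟨‖p.1‖, norm_nonneg _, fun z => ⟨fun hz => ?_, fun hz => ?_⟩⟩
  · have hz' : ((z, s) : EuclideanSpace ℝ (Fin k) × ℝ) ∈ X ∩ {p | p.2 = s} := ⟨hz, rfl⟩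
    exact hmax' (z, s) hz'
  · refine hd _ hp _ hz ?_
    rw [hps]

theorem exists_bound {k : ℕ} {X : Set (EuclideanSpace ℝ (Fin k) × ℝ)} (hX : IsCompact X) :
    ∃ R : ℝ, 0 < R ∧ ∀ p ∈ X, ‖p.1‖ ≤ R ∧ |p.2| ≤ R := by
  obtain ⟨R, hR⟩ := hX.isBounded.exists_norm_le
  refine ⟨max R 1, by positivity, fun p hp => ?_⟩
  have := hR p hp
  rw [Prod.norm_def] at this
  exact ⟨((le_max_left _ _).trans this).trans (le_max_left _ _),
    ((le_max_right _ _).trans this).trans (le_max_left _ _)⟩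

/-- Volume of the part of `X` of height between `0` and `s`. -/
noncomputable def headVol {k : ℕ} (X : Set (EuclideanSpace ℝ (Fin k) × ℝ)) (s : ℝ) : ℝ :=
  volume.real (X ∩ {p | 0 ≤ p.2 ∧ p.2 ≤ s})

theorem inter_fin {k : ℕ} {X : Set (EuclideanSpace ℝ (Fin k) × ℝ)} (hX : IsCompact X)
    (Y : Set (EuclideanSpace ℝ (Fin k) × ℝ)) : volume (X ∩ Y) ≠ ⊤ :=
  ((measure_mono inter_subset_left).trans_lt hX.measure_lt_top).ne

theorem head_upper {k : ℕ} {X : Set (EuclideanSpace ℝ (Fin k) × ℝ)} (hX : IsCompact X)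
    (hd : DownSet X) {s₁ s₂ r : ℝ} (h0 : 0 ≤ s₁) (h12 : s₁ ≤ s₂) (hr : 0 ≤ r)
    (h : ∀ y : EuclideanSpace ℝ (Fin k), (y, s₁) ∈ X → ‖y‖ ≤ r) :
    headVol X s₂ ≤ headVol X s₁ + r ^ k * omegaBall k * (s₂ - s₁) := by
  have hsub : X ∩ {p | 0 ≤ p.2 ∧ p.2 ≤ s₂} ⊆ (X ∩ {p | 0 ≤ p.2 ∧ p.2 ≤ s₁}) ∪
      Metric.closedBall 0 r ×ˢ Icc s₁ s₂ := by
    rintro ⟨y, s⟩ ⟨h1, h2, h3⟩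
    simp only at h2 h3
    rcases le_total s s₁ with hs | hs
    · left; exact ⟨h1, h2, hs⟩
    · right
      refine ⟨?_, hs, h3⟩
      rw [mem_closedBall_zero_iff]
      exact h _ (hd _ h1 _ (le_refl _) (by simpa [abs_of_nonneg h0, abs_of_nonneg h2] using hs))
  calc headVol X s₂ ≤ _ := measureReal_mono hsub (measure_union_ne_top (inter_fin hX _) (box_fin _ _ _ _))
    _ ≤ _ := measureReal_union_le _ _
    _ = _ := by rw [box_real _ hr, Real.volume_real_Icc_of_le h12]; rfl

theorem head_lower {k : ℕ} {X : Set (EuclideanSpace ℝ (Fin k) × ℝ)} (hX : IsCompact X)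
    (hd : DownSet X) {s₁ s₂ r : ℝ} (h0 : 0 ≤ s₁) (h12 : s₁ ≤ s₂) (hr : 0 ≤ r)
    (h : ∀ y : EuclideanSpace ℝ (Fin k), ‖y‖ ≤ r → (y, s₂) ∈ X) :
    headVol X s₁ + r ^ k * omegaBall k * (s₂ - s₁) ≤ headVol X s₂ := by
  have hsub : (X ∩ {p | 0 ≤ p.2 ∧ p.2 ≤ s₁}) ∪ Metric.closedBall 0 r ×ˢ Ioc s₁ s₂ ⊆
      X ∩ {p | 0 ≤ p.2 ∧ p.2 ≤ s₂} := by
    rintro ⟨y, s⟩ (⟨h1, h2, h3⟩ | ⟨h1, h2, h3⟩)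
    · exact ⟨h1, h2, h3.trans h12⟩
    · simp only at h2 h3
      rw [mem_closedBall_zero_iff] at h1
      refine ⟨hd _ (h y h1) _ (le_refl _) ?_, h0.trans h2.le, h3⟩
      simpa [abs_of_nonneg (h0.trans h2.le), abs_of_nonneg (h0.trans h12)] using h3
  have hfin : volume (Metric.closedBall (0 : EuclideanSpace ℝ (Fin k)) r ×ˢ Ioc s₁ s₂) ≠ ⊤ :=
    ne_top_of_le_ne_top (box_fin 0 r s₁ s₂) (measure_mono (prod_mono le_rfl Ioc_subset_Icc_self))
  have hdis : Disjoint (X ∩ {p | 0 ≤ p.2 ∧ p.2 ≤ s₁}) (Metric.closedBall 0 r ×ˢ Ioc s₁ s₂) := by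
    rw [Set.disjoint_left]
    rintro p ⟨_, _, h2⟩ ⟨_, h3, _⟩
    exact absurd h2 (not_le.2 h3)
  have hm : MeasurableSet (Metric.closedBall (0 : EuclideanSpace ℝ (Fin k)) r ×ˢ Ioc s₁ s₂) :=
    Metric.isClosed_closedBall.measurableSet.prod measurableSet_Ioc
  calc _ = volume.real ((X ∩ {p | 0 ≤ p.2 ∧ p.2 ≤ s₁}) ∪ Metric.closedBall 0 r ×ˢ Ioc s₁ s₂) := by
        rw [measureReal_union hdis hm (inter_fin hX _) hfin, box_real _ hr,
          Real.volume_real_Ioc_of_le h12]; rfl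
    _ ≤ _ := measureReal_mono hsub (inter_fin hX _)

theorem head_mono {k : ℕ} {X : Set (EuclideanSpace ℝ (Fin k) × ℝ)} (hX : IsCompact X)
    {s₁ s₂ : ℝ} (h12 : s₁ ≤ s₂) : headVol X s₁ ≤ headVol X s₂ :=
  measureReal_mono (fun _ hp => ⟨hp.1, hp.2.1, hp.2.2.trans h12⟩) (inter_fin hX _)

theorem head_zero {k : ℕ} {X : Set (EuclideanSpace ℝ (Fin k) × ℝ)} :
    headVol X 0 = 0 := by
  have : volume (X ∩ {p | 0 ≤ p.2 ∧ p.2 ≤ 0}) = 0 :=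
    measure_mono_null (fun p hp => le_antisymm hp.2.2 hp.2.1) (plane_null 0)
  simp [headVol, Measure.real, this]

theorem head_ivt {k : ℕ} {X : Set (EuclideanSpace ℝ (Fin k) × ℝ)} (hX : IsCompact X)
    (hd : DownSet X) {m : ℝ} (hm : 0 ≤ m) (hm' : m ≤ volume.real (X ∩ {p | 0 ≤ p.2})) :
    ∃ s, 0 ≤ s ∧ headVol X s = m := by
  obtain ⟨R, hR0, hR⟩ := exists_bound hX
  have hend : headVol X R = volume.real (X ∩ {p | 0 ≤ p.2}) := by
    unfold headVol; congr 1
    ext p; constructor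
    · rintro ⟨h1, h2, h3⟩; exact ⟨h1, h2⟩
    · rintro ⟨h1, h2⟩; exact ⟨h1, h2, (le_abs_self _).trans (hR p h1).2⟩
  have hcont : ContinuousOn (headVol X) (Icc 0 R) := by
    have hL : LipschitzOnWith (Real.toNNReal (R ^ k * omegaBall k)) (headVol X) (Icc 0 R) := by
      have hω := omegaBall_pos k
      apply LipschitzOnWith.of_le_add_mul
      intro x hx y hy
      rw [Real.coe_toNNReal _ (by positivity)]
      rcases le_total x y with h | h
      · have := head_mono hX h
        have : 0 ≤ R ^ k * omegaBall k * dist x y := by positivity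
        linarith
      · rw [Real.dist_eq, abs_of_nonneg (sub_nonneg.2 h)]
        exact head_upper hX hd hy.1 h hR0.le fun y hy => (hR _ hy).1
    exact hL.continuousOn
  obtain ⟨s, hs, hs'⟩ := intermediate_value_Icc hR0.le hcont
    (show m ∈ Icc (headVol X 0) (headVol X R) by rw [head_zero, hend]; exact ⟨hm, hm'⟩)
  exact ⟨s, hs.1, hs'⟩

theorem tail_pos_rad {k : ℕ} (hk : 1 ≤ k) {X : Set (EuclideanSpace ℝ (Fin k) × ℝ)}
    (hX : IsCompact X) (hd : DownSet X) {s W : ℝ} (hs : 0 ≤ s) (hW : 0 < W)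
    (hv : W ≤ volume.real (X ∩ {p | s ≤ p.2})) :
    ∃ r : ℝ, 0 < r ∧ ∀ y : EuclideanSpace ℝ (Fin k), (y, s) ∈ X ↔ ‖y‖ ≤ r := by
  have hne : volume (X ∩ {p | s ≤ p.2}) ≠ 0 := by
    intro h
    rw [Measure.real, h] at hv
    simp at hv; linarith
  obtain ⟨⟨y, σ⟩, hp, hp2⟩ := nonempty_of_measure_ne_zero hne
  have hp2 : s ≤ σ := hp2
  have hys : (y, s) ∈ X := hd _ hp _ (le_refl _)
    (by simpa [abs_of_nonneg hs, abs_of_nonneg (hs.trans hp2)] using hp2)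
  obtain ⟨r, hr, hr'⟩ := exists_rad hX hd ⟨y, hys⟩
  refine ⟨r, lt_of_le_of_ne hr ?_, hr'⟩
  rintro rfl
  obtain ⟨R, hR0, hR⟩ := exists_bound hX
  have hsub : X ∩ {p | s ≤ p.2} ⊆ Metric.closedBall 0 0 ×ˢ Icc s R := by
    rintro ⟨y, σ⟩ ⟨h1, h2⟩
    have h2 : s ≤ σ := h2
    refine ⟨?_, h2, (le_abs_self _).trans (hR _ h1).2⟩
    rw [mem_closedBall_zero_iff]
    exact (hr' y).1 (hd _ h1 _ (le_refl _)
      (by simpa [abs_of_nonneg hs, abs_of_nonneg (hs.trans h2)] using h2))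
  have := measureReal_mono (μ := volume) hsub (box_fin _ _ _ _)
  rw [box_real _ le_rfl, zero_pow (by omega)] at this
  linarith

theorem radii_close {k : ℕ} (hk : 1 ≤ k) {A B : Set (EuclideanSpace ℝ (Fin k) × ℝ)}
    (hA : IsCompact A) (hB : IsCompact B) (dA : DownSet A) (dB : DownSet B)
    {t : ℝ} (ht : 0 < t) (ht1 : t < 1) {m s s' W d : ℝ} (hs : 0 ≤ s) (hs' : 0 ≤ s')
    (hm : headVol A s = m) (hm' : headVol B s' = m) (hW : 0 < W)
    (hAW : m + W ≤ volume.real (A ∩ {p | 0 ≤ p.2}))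
    (hBW : m + W ≤ volume.real (B ∩ {p | 0 ≤ p.2}))
    (hS : volume.real ((t • A + (1 - t) • B) ∩ {p | 0 ≤ p.2}) ≤ m + W + d) :
    ∃ r r' : ℝ, 0 < r ∧ 0 < r' ∧
      (∀ y : EuclideanSpace ℝ (Fin k), (y, s) ∈ A ↔ ‖y‖ ≤ r) ∧
      (∀ y : EuclideanSpace ℝ (Fin k), (y, s') ∈ B ↔ ‖y‖ ≤ r') ∧
      W * (t * (1 - t) * ((1 - r' / r) ^ 2 / (r' / r))) ≤ d := by
  have h1t : 0 < 1 - t := by linarith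
  have m0 : 0 ≤ m := by rw [← hm]; exact measureReal_nonneg
  have tail : ∀ X : Set (EuclideanSpace ℝ (Fin k) × ℝ), IsCompact X → ∀ s : ℝ,
      headVol X s = m → m + W ≤ volume.real (X ∩ {p | 0 ≤ p.2}) →
      W ≤ volume.real (X ∩ {p | s ≤ p.2}) := by
    intro X hX s hm hXW
    have hsub : X ∩ {p | 0 ≤ p.2} ⊆ (X ∩ {p | 0 ≤ p.2 ∧ p.2 ≤ s}) ∪ (X ∩ {p | s ≤ p.2}) := by
      rintro p ⟨h1, h2⟩
      rcases le_total p.2 s with h | h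
      · left; exact ⟨h1, h2, h⟩
      · right; exact ⟨h1, h⟩
    have h3 := measureReal_mono (μ := volume) hsub
      (measure_union_ne_top (inter_fin hX _) (inter_fin hX _))
    have h4 := measureReal_union_le (μ := volume) (X ∩ {p | 0 ≤ p.2 ∧ p.2 ≤ s}) (X ∩ {p | s ≤ p.2})
    have h5 : volume.real (X ∩ {p | 0 ≤ p.2 ∧ p.2 ≤ s}) = m := hm
    linarith
  have tA := tail A hA s hm hAW
  have tB := tail B hB s' hm' hBW
  obtain ⟨r, hr, hrA⟩ := tail_pos_rad hk hA dA hs hW tA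
  obtain ⟨r', hr', hrB⟩ := tail_pos_rad hk hB dB hs' hW tB
  refine ⟨r, r', hr, hr', hrA, hrB, ?_⟩
  obtain ⟨r0, hr0, hrA0⟩ := tail_pos_rad hk hA dA le_rfl hW (by linarith)
  obtain ⟨r0', hr0', hrB0⟩ := tail_pos_rad hk hB dB le_rfl hW (by linarith)
  set S := t • A + (1 - t) • B with hSdef
  have cS : IsCompact S := compactS hA hB t
  set v := t * s + (1 - t) * s' with hv
  have hv0 : 0 ≤ v := by positivity
  have memS' : ∀ p ∈ A, ∀ q ∈ B, t • p + (1 - t) • q ∈ S := fun p hp q hq =>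
    Set.add_mem_add (Set.smul_mem_smul_set hp) (Set.smul_mem_smul_set hq)
  have cl1 : ∀ a : ℝ, IsClosed {p : EuclideanSpace ℝ (Fin k) × ℝ | a ≤ p.2} := fun a =>
    isClosed_le continuous_const continuous_snd
  have cl2 : ∀ a : ℝ, IsClosed {p : EuclideanSpace ℝ (Fin k) × ℝ | 0 ≤ p.2 ∧ p.2 ≤ a} := fun a =>
    (isClosed_le continuous_const continuous_snd).inter
      (isClosed_le continuous_snd continuous_const)
  have down : ∀ X : Set (EuclideanSpace ℝ (Fin k) × ℝ), DownSet X → ∀ (y : EuclideanSpace ℝ (Fin k))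
      (a b : ℝ), 0 ≤ a → a ≤ b → (y, b) ∈ X → (y, a) ∈ X := by
    intro X hX y a b ha hab h
    exact hX _ h _ (le_refl _) (by simpa [abs_of_nonneg ha, abs_of_nonneg (ha.trans hab)] using hab)
  -- tail
  have B1 := bm_piece (X := A ∩ {p | s ≤ p.2}) (Y := B ∩ {p | s' ≤ p.2}) (Z := S ∩ {p | v ≤ p.2})
    (hA.inter_right (cl1 _)) (hB.inter_right (cl1 _)) (cS.inter_right (cl1 _)) (s := s) (s' := s')
    hr hr' ht ht1
    (by
      rintro ⟨y, σ⟩ ⟨h1, h2⟩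
      exact ⟨h2, (hrA y).1 (down A dA y s σ hs h2 h1)⟩)
    (fun y hy => ⟨(hrA y).2 hy, le_refl s⟩)
    (fun y σ σ' h1 h2 h3 => ⟨down A dA y σ' σ (hs.trans h2) h3 h1.1, h2⟩)
    (by
      rintro ⟨y, σ⟩ ⟨h1, h2⟩
      exact ⟨h2, (hrB y).1 (down B dB y s' σ hs' h2 h1)⟩)
    (fun y hy => ⟨(hrB y).2 hy, le_refl s'⟩)
    (fun y σ σ' h1 h2 h3 => ⟨down B dB y σ' σ (hs'.trans h2) h3 h1.1, h2⟩)
    (by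
      rintro p ⟨hp1, hp2⟩ q ⟨hq1, hq2⟩
      have hp2 : s ≤ p.2 := hp2
      have hq2 : s' ≤ q.2 := hq2
      refine ⟨memS' p hp1 q hq1, ?_⟩
      change v ≤ t * p.2 + (1 - t) * q.2
      rw [hv]; gcongr)
  -- head
  have B2 := bm_piece (X := A ∩ {p | 0 ≤ p.2 ∧ p.2 ≤ s}) (Y := B ∩ {p | 0 ≤ p.2 ∧ p.2 ≤ s'})
    (Z := S ∩ {p | 0 ≤ p.2 ∧ p.2 ≤ v})
    (hA.inter_right (cl2 _)) (hB.inter_right (cl2 _)) (cS.inter_right (cl2 _)) (s := 0) (s' := 0)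
    hr0 hr0' ht ht1
    (by
      rintro ⟨y, σ⟩ ⟨h1, h2, h3⟩
      exact ⟨h2, (hrA0 y).1 (down A dA y 0 σ le_rfl h2 h1)⟩)
    (fun y hy => ⟨(hrA0 y).2 hy, le_refl _, hs⟩)
    (fun y σ σ' h1 h2 h3 => ⟨down A dA y σ' σ h2 h3 h1.1, h2, h3.trans h1.2.2⟩)
    (by
      rintro ⟨y, σ⟩ ⟨h1, h2, h3⟩
      exact ⟨h2, (hrB0 y).1 (down B dB y 0 σ le_rfl h2 h1)⟩)
    (fun y hy => ⟨(hrB0 y).2 hy, le_refl _, hs'⟩)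
    (fun y σ σ' h1 h2 h3 => ⟨down B dB y σ' σ h2 h3 h1.1, h2, h3.trans h1.2.2⟩)
    (by
      rintro p ⟨hp1, hp2, hp3⟩ q ⟨hq1, hq2, hq3⟩
      refine ⟨memS' p hp1 q hq1, ?_, ?_⟩
      · change 0 ≤ t * p.2 + (1 - t) * q.2
        positivity
      · change t * p.2 + (1 - t) * q.2 ≤ v
        rw [hv]; gcongr)
  have e1 : volume.real (A ∩ {p | 0 ≤ p.2 ∧ p.2 ≤ s}) = m := hm
  have e2 : volume.real (B ∩ {p | 0 ≤ p.2 ∧ p.2 ≤ s'}) = m := hm'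
  have P1 := phi_bound ht ht1 (div_pos hr' hr) k hk
  have P2 := phi_bound ht ht1 (div_pos hr0' hr0) k hk
  rw [one_div_div] at P1 P2
  rw [e1, e2] at B2
  have B2' : m ≤ volume.real (S ∩ {p | 0 ≤ p.2 ∧ p.2 ≤ v}) := by
    refine le_trans ?_ B2
    have : 0 ≤ t * (1 - t) * ((1 - r0' / r0) ^ 2 / (r0' / r0)) := by positivity
    calc m = 1 * m := by ring
      _ ≤ ((t + (1 - t) * (r0' / r0)) ^ k * (t + (1 - t) * (r0 / r0') ^ k)) * m := by
        gcongr; linarith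
      _ = _ := by ring
  have B1' : (1 + t * (1 - t) * ((1 - r' / r) ^ 2 / (r' / r))) * W ≤
      volume.real (S ∩ {p | v ≤ p.2}) := by
    refine le_trans ?_ B1
    calc _ ≤ ((t + (1 - t) * (r' / r)) ^ k * (t + (1 - t) * (r / r') ^ k)) * W := by gcongr
      _ = (t + (1 - t) * (r' / r)) ^ k * (t * W + (1 - t) * ((r / r') ^ k * W)) := by ring
      _ ≤ _ := by gcongr
  have B3 : volume.real (S ∩ {p | 0 ≤ p.2 ∧ p.2 ≤ v}) + volume.real (S ∩ {p | v ≤ p.2}) ≤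
      volume.real (S ∩ {p | 0 ≤ p.2}) := by
    have e3 : volume.real (S ∩ {p | v ≤ p.2}) = volume.real (S ∩ {p | v < p.2}) := by
      simp only [Measure.real, plane_cut]
    have mm : MeasurableSet {p : EuclideanSpace ℝ (Fin k) × ℝ | v < p.2} :=
      measurableSet_lt measurable_const measurable_snd
    rw [e3, ← measureReal_union _ (cS.measurableSet.inter mm) (inter_fin cS _) (inter_fin cS _)]
    · refine measureReal_mono ?_ (inter_fin cS _)
      rintro p (⟨h1, h2, h3⟩ | ⟨h1, h2⟩)
      · exact ⟨h1, h2⟩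
      · exact ⟨h1, hv0.trans (le_of_lt (show v < p.2 from h2))⟩
    · rw [Set.disjoint_left]
      rintro p ⟨_, _, h2⟩ ⟨_, h3⟩
      exact absurd h2 (not_le.2 h3)
  nlinarith

theorem ratio_bound {c ζ : ℝ} (hc : 0 < c) (hζ : 0 ≤ ζ) (h : (1 - c) ^ 2 / c ≤ ζ ^ 2) :
    1 - ζ ≤ c ∧ (1 - ζ) * c ≤ 1 := by
  rw [div_le_iff₀ hc] at h
  rcases le_total c 1 with h1 | h1
  · have : (1 - c) ^ 2 ≤ ζ ^ 2 := h.trans (by nlinarith [sq_nonneg ζ])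
    have := abs_le_of_sq_le_sq' this hζ
    constructor
    · linarith
    · nlinarith
  · refine ⟨by linarith, ?_⟩
    have : (c - 1) ^ 2 ≤ (ζ * c) ^ 2 := by nlinarith [sq_nonneg ζ, mul_nonneg (sq_nonneg ζ) hc.le]
    have := abs_le_of_sq_le_sq' this (by positivity)
    linarith

/-- Grid comparison of heights. -/
theorem grid {k : ℕ} (hk : 1 ≤ k) {A B : Set (EuclideanSpace ℝ (Fin k) × ℝ)}
    (hA : IsCompact A) (hB : IsCompact B) (dA : DownSet A) (dB : DownSet B)
    {s0 q : ℝ} (hs0 : 0 ≤ s0) (hq : 0 < q)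
    (T : ℝ → ℝ) (ra rb : ℝ → ℝ)
    (hT0 : ∀ s ∈ Icc 0 s0, 0 ≤ T s) (hT : ∀ s ∈ Icc 0 s0, headVol B (T s) = headVol A s)
    (hra : ∀ s ∈ Icc 0 s0, 0 < ra s) (hrb : ∀ s ∈ Icc 0 s0, 0 < rb s)
    (hA' : ∀ s ∈ Icc 0 s0, ∀ y : EuclideanSpace ℝ (Fin k), (y, s) ∈ A ↔ ‖y‖ ≤ ra s)
    (hB' : ∀ s ∈ Icc 0 s0, ∀ y : EuclideanSpace ℝ (Fin k), (y, T s) ∈ B ↔ ‖y‖ ≤ rb s)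
    (hab : ∀ s ∈ Icc 0 s0, q * rb s ^ k ≤ ra s ^ k) :
    q * s0 ≤ T s0 := by
  have hω := omegaBall_pos k
  have anti : ∀ x ∈ Icc 0 s0, ∀ y ∈ Icc 0 s0, x ≤ y → ra y ≤ ra x := by
    intro x hx y hy hxy
    have hn : ‖ra y • (EuclideanSpace.single (⟨0, hk⟩ : Fin k) (1 : ℝ))‖ = ra y := by
      rw [norm_smul, EuclideanSpace.norm_single]
      simp [abs_of_pos (hra y hy)]
    have h1 := (hA' y hy (ra y • (EuclideanSpace.single (⟨0, hk⟩ : Fin k) (1 : ℝ)))).2 hn.le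
    have h2 := (hA' x hx (ra y • (EuclideanSpace.single (⟨0, hk⟩ : Fin k) (1 : ℝ)))).1
      (dA _ h1 _ le_rfl (by simpa [abs_of_nonneg hx.1, abs_of_nonneg hy.1] using hxy))
    rwa [hn] at h2
  have hs0m : s0 ∈ Icc 0 s0 := ⟨hs0, le_rfl⟩
  -- one step
  have step : ∀ x ∈ Icc 0 s0, ∀ y ∈ Icc 0 s0, x ≤ y →
      q * (y - x) * (1 - (ra x ^ k - ra y ^ k) / ra s0 ^ k) ≤ T y - T x := by
    intro x hx y hy hxy
    have hL := head_lower hA dA hx.1 hxy (hra y hy).le (fun z hz => (hA' y hy z).2 hz)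
    have py : 0 < ra y ^ k := pow_pos (hra y hy) k
    have px : 0 < ra x ^ k := pow_pos (hra x hx) k
    have p0 : 0 < ra s0 ^ k := pow_pos (hra s0 hs0m) k
    rcases lt_or_ge (T y) (T x) with hlt | hle
    · have h1 := head_mono hB hlt.le
      rw [hT x hx, hT y hy] at h1
      have h2 : ra y ^ k * omegaBall k * (y - x) ≤ 0 := by linarith
      have h3 : y - x ≤ 0 := by
        by_contra h
        push Not at h
        have := mul_pos (mul_pos py hω) h
        linarith
      have : x = y := le_antisymm hxy (by linarith)
      subst this
      exact absurd hlt (lt_irrefl _)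
    · have hU := head_upper hB dB (hT0 x hx) hle (hrb x hx).le (fun z hz => (hB' x hx z).1 hz)
      rw [hT x hx, hT y hy] at hU
      have h1 : omegaBall k * (ra y ^ k * (y - x)) ≤ omegaBall k * (rb x ^ k * (T y - T x)) := by
        nlinarith
      have h2 := le_of_mul_le_mul_left h1 hω
      have h3 : q * (y - x) * ra y ^ k ≤ ra x ^ k * (T y - T x) := by
        have a1 := mul_le_mul_of_nonneg_left h2 hq.le
        have a2 := mul_le_mul_of_nonneg_right (hab x hx) (sub_nonneg.2 hle)
        nlinarith
      have h4 : q * (y - x) * (ra y ^ k / ra x ^ k) ≤ T y - T x := by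
        rw [← mul_div_assoc, div_le_iff₀ px]; linarith
      have h5 : ra s0 ^ k ≤ ra x ^ k :=
        pow_le_pow_left₀ (hra s0 hs0m).le (anti x hx s0 hs0m hx.2) k
      have h6 : ra y ^ k ≤ ra x ^ k := pow_le_pow_left₀ (hra y hy).le (anti x hx y hy hxy) k
      refine le_trans ?_ h4
      have h7 : (ra x ^ k - ra y ^ k) / ra x ^ k ≤ (ra x ^ k - ra y ^ k) / ra s0 ^ k :=
        div_le_div_of_nonneg_left (by linarith) p0 h5
      have h8 : ra y ^ k / ra x ^ k = 1 - (ra x ^ k - ra y ^ k) / ra x ^ k := by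
        field_simp; ring
      rw [h8]
      have : 0 ≤ q * (y - x) := mul_nonneg hq.le (by linarith)
      apply mul_le_mul_of_nonneg_left _ this
      linarith
  have p0 : 0 < ra s0 ^ k := pow_pos (hra s0 hs0m) k
  have h0m : (0 : ℝ) ∈ Icc 0 s0 := ⟨le_rfl, hs0⟩
  have key : ∀ N : ℕ, 0 < N → q * s0 - q * s0 * (ra 0 ^ k / ra s0 ^ k) / N ≤ T s0 := by
    intro N hN
    have hN' : (0 : ℝ) < N := by exact_mod_cast hN
    have mem : ∀ i : ℕ, i ≤ N → (i : ℝ) * (s0 / N) ∈ Icc 0 s0 := by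
      intro i hi
      refine ⟨by positivity, ?_⟩
      have : (i : ℝ) ≤ N := by exact_mod_cast hi
      calc (i : ℝ) * (s0 / N) ≤ N * (s0 / N) := by gcongr
        _ = s0 := by field_simp
    have ind : ∀ i : ℕ, i ≤ N → q * (s0 / N) * (i - (ra 0 ^ k - ra (i * (s0 / N)) ^ k) / ra s0 ^ k)
        ≤ T (i * (s0 / N)) := by
      intro i
      induction i with
      | zero => intro _; simpa using hT0 0 h0m
      | succ i ih =>
        intro hi
        have h1 := ih (by omega)
        have h2 := step _ (mem i (by omega)) _ (mem (i+1) hi) (by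
          have : 0 ≤ s0 / N := by positivity
          push_cast; linarith)
        have h3 : ((i + 1 : ℕ) : ℝ) * (s0 / N) - i * (s0 / N) = s0 / N := by push_cast; ring
        rw [h3] at h2
        have e : q * (s0 / N) * (((i + 1 : ℕ) : ℝ) - (ra 0 ^ k - ra ((i + 1 : ℕ) * (s0 / N)) ^ k) / ra s0 ^ k)
          = q * (s0 / N) * (i - (ra 0 ^ k - ra (i * (s0 / N)) ^ k) / ra s0 ^ k) +
            q * (s0 / N) * (1 - (ra (i * (s0 / N)) ^ k - ra ((i + 1 : ℕ) * (s0 / N)) ^ k) / ra s0 ^ k) := by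
          push_cast; ring
        rw [e]; linarith
    have h := ind N le_rfl
    have e : (N : ℝ) * (s0 / N) = s0 := by field_simp
    rw [e] at h
    refine le_trans ?_ h
    have e2 : q * (s0 / N) * (N - (ra 0 ^ k - ra s0 ^ k) / ra s0 ^ k) =
      q * s0 - q * s0 * (ra 0 ^ k / ra s0 ^ k) / N + q * (s0 / N) := by
      field_simp; ring
    rw [e2]
    have : 0 ≤ q * (s0 / N) := by positivity
    linarith
  by_contra hcon
  push Not at hcon
  obtain ⟨N, hN⟩ := exists_nat_gt (q * s0 * (ra 0 ^ k / ra s0 ^ k) / (q * s0 - T s0))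
  have hpos : 0 < q * s0 - T s0 := by linarith
  have r0 := hra 0 h0m
  have r1 := hra s0 hs0m
  have hN0 : (0 : ℝ) < N := lt_of_le_of_lt (by positivity) hN
  have h1 := key N (by exact_mod_cast hN0)
  rw [div_lt_iff₀ hpos] at hN
  have : q * s0 * (ra 0 ^ k / ra s0 ^ k) / N < q * s0 - T s0 := by
    rw [div_lt_iff₀ hN0]; linarith
  linarith

theorem vol_smul {k : ℕ} (D : Set (EuclideanSpace ℝ (Fin k) × ℝ)) {q : ℝ} (hq : 0 ≤ q) :
    volume.real (q • D) = q ^ (k + 1) * volume.real D := by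
  have := volHaar k
  rw [Measure.real, Measure.addHaar_smul, finrankProd, ENNReal.toReal_mul,
    ENNReal.toReal_ofReal (abs_nonneg _), abs_of_nonneg (by positivity)]
  rfl

set_option maxHeartbeats 1000000 in
theorem partI {k : ℕ} (hk : 1 ≤ k) {A B : Set (EuclideanSpace ℝ (Fin k) × ℝ)}
    (hA : IsCompact A) (hB : IsCompact B) (dA : DownSet A) (dB : DownSet B)
    {τ t x : ℝ} (hτ : 0 < τ) (hτ2 : τ ≤ 1 / 2) (ht : τ ≤ t) (ht1 : t ≤ 1 - τ)
    (hx : 0 < x) (hxτ : x ≤ τ / 4)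
    (vA : 1 - x ^ 4 ≤ volume.real A) (vB : 1 - x ^ 4 ≤ volume.real B)
    (vS : volume.real (t • A + (1 - t) • B) ≤ 1 + x ^ 4) :
    1 - (2 * k * (k + 1) + 2) * (x / τ) ≤ volume.real (A ∩ B) := by
  have t0 : 0 < t := by linarith
  have t1 : t < 1 := by linarith
  have hA2 := half_volume hA dA
  have hB2 := half_volume hB dB
  have hS2 := half_volume (compactS hA hB t) (downS dA dB t0 t1)
  have hx1 : x ≤ 1 / 8 := by linarith
  have hxx : x ^ 2 ≤ 1 / 64 := by nlinarith
  have hx4 : x ^ 4 ≤ x ^ 2 * (1 / 64) := by nlinarith [sq_nonneg x]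
  have hx2 : 0 < x ^ 2 := by positivity
  set ζ := 2 * x / τ with hζ
  have ζ0 : 0 ≤ ζ := by positivity
  have ζ1 : ζ ≤ 1 / 2 := by
    rw [hζ, div_le_iff₀ hτ]; linarith
  obtain ⟨s0, hs0, hm0⟩ := head_ivt hA dA (m := 1 / 2 - x ^ 2) (by linarith) (by linarith)
  have ex : ∀ s : ℝ, ∃ T ra rb : ℝ, s ∈ Icc 0 s0 → 0 ≤ T ∧ headVol B T = headVol A s ∧ 0 < ra ∧
      0 < rb ∧ (∀ y : EuclideanSpace ℝ (Fin k), (y, s) ∈ A ↔ ‖y‖ ≤ ra) ∧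
      (∀ y : EuclideanSpace ℝ (Fin k), (y, T) ∈ B ↔ ‖y‖ ≤ rb) ∧
      (1 - ζ) * ra ≤ rb ∧ (1 - ζ) * rb ≤ ra := by
    intro s
    by_cases hs : s ∈ Icc 0 s0
    swap
    · exact ⟨0, 0, 0, fun h => absurd h hs⟩
    have hm : headVol A s ≤ 1 / 2 - x ^ 2 := by rw [← hm0]; exact head_mono hA hs.2
    have hmn : 0 ≤ headVol A s := measureReal_nonneg
    obtain ⟨T, hT, hTm⟩ := head_ivt hB dB (m := headVol A s) hmn (by linarith)
    obtain ⟨r, r', hr, hr', h1, h2, h3⟩ := radii_close hk hA hB dA dB t0 t1 hs.1 hT rfl hTm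
      (W := (1 - x ^ 4) / 2 - headVol A s) (d := x ^ 4) (by linarith) (by linarith)
      (by linarith) (by linarith)
    refine ⟨T, r, r', fun _ => ⟨hT, hTm, hr, hr', h1, h2, ?_⟩⟩
    have hc : 0 < r' / r := by positivity
    have hQ : (1 - r' / r) ^ 2 / (r' / r) ≤ ζ ^ 2 := by
      set Q := (1 - r' / r) ^ 2 / (r' / r) with hQd
      have Q0 : 0 ≤ Q := by positivity
      have a1 : τ / 2 ≤ t * (1 - t) := by nlinarith
      have a2 : x ^ 2 / 2 ≤ (1 - x ^ 4) / 2 - headVol A s := by linarith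
      have a3 : x ^ 2 / 2 * (τ / 2 * Q) ≤ x ^ 4 := by
        refine le_trans ?_ h3
        gcongr; linarith
      have a4 : τ * Q ≤ 4 * x ^ 2 := by
        have : x ^ 2 * (τ * Q) ≤ x ^ 2 * (4 * x ^ 2) := by nlinarith
        exact le_of_mul_le_mul_left this hx2
      rw [hζ, div_pow, le_div_iff₀ (by positivity)]
      nlinarith [mul_nonneg hτ.le Q0]
    obtain ⟨b1, b2⟩ := ratio_bound hc ζ0 hQ
    constructor
    · rwa [le_div_iff₀ hr] at b1
    · rw [← mul_div_assoc, div_le_iff₀ hr] at b2; linarith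
  choose T ra rb hT using ex
  set q := (1 - ζ) ^ k with hq
  have q0 : 0 < q := by apply pow_pos; linarith
  have q1 : q ≤ 1 := pow_le_one₀ (by linarith) (by linarith)
  have qz : q ≤ 1 - ζ := pow_le_of_le_one (by linarith) (by linarith) (by omega)
  have G : ∀ s ∈ Icc 0 s0, q * s ≤ T s := by
    intro s hs
    have sub : ∀ u ∈ Icc 0 s, u ∈ Icc 0 s0 := fun u hu => ⟨hu.1, hu.2.trans hs.2⟩
    refine grid hk hA hB dA dB hs.1 q0 T ra rb (fun u hu => (hT u (sub u hu)).1)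
      (fun u hu => (hT u (sub u hu)).2.1) (fun u hu => (hT u (sub u hu)).2.2.1)
      (fun u hu => (hT u (sub u hu)).2.2.2.1) (fun u hu => (hT u (sub u hu)).2.2.2.2.1)
      (fun u hu => (hT u (sub u hu)).2.2.2.2.2.1) ?_
    intro u hu
    have h := hT u (sub u hu)
    rw [hq, ← mul_pow]
    exact pow_le_pow_left₀ (mul_nonneg (by linarith) h.2.2.2.1.le) h.2.2.2.2.2.2.2 k
  set D := A ∩ {p | |p.2| ≤ s0} with hD
  have cD : IsCompact D := hA.inter_right (isClosed_le continuous_snd.abs continuous_const)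
  have dD : DownSet D := by
    intro p hp w h1 h2
    exact ⟨dA p hp.1 w h1 h2, h2.trans hp.2⟩
  have vD : volume.real D = 1 - 2 * x ^ 2 := by
    rw [half_volume cD dD]
    have : D ∩ {p | 0 ≤ p.2} = A ∩ {p | 0 ≤ p.2 ∧ p.2 ≤ s0} := by
      ext p; constructor
      · rintro ⟨⟨h1, h2⟩, h3⟩
        exact ⟨h1, h3, (le_abs_self _).trans h2⟩
      · rintro ⟨h1, h2, h3⟩
        exact ⟨⟨h1, show |p.2| ≤ s0 by rwa [abs_of_nonneg h2]⟩, h2⟩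
    rw [this]
    have : volume.real (A ∩ {p | 0 ≤ p.2 ∧ p.2 ≤ s0}) = 1 / 2 - x ^ 2 := hm0
    rw [this]; ring
  have hsub : q • D ⊆ A ∩ B := by
    rintro _ ⟨⟨y, σ⟩, ⟨hp, hσ⟩, rfl⟩
    have hσ : |σ| ≤ s0 := hσ
    have hs : |σ| ∈ Icc 0 s0 := ⟨abs_nonneg _, hσ⟩
    obtain ⟨c1, c2, c3, c4, c5, c6, c7, c8⟩ := hT _ hs
    have n1 : ‖q • y‖ = q * ‖y‖ := by rw [norm_smul, Real.norm_of_nonneg q0.le]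
    have n2 : |q • σ| = q * |σ| := by rw [smul_eq_mul, abs_mul, abs_of_pos q0]
    have hy : ‖y‖ ≤ ra |σ| := (c5 y).1 (dA _ hp _ le_rfl (by simp))
    refine ⟨dA _ hp _ ?_ ?_, ?_⟩
    · change ‖q • y‖ ≤ ‖y‖
      rw [n1]; exact mul_le_of_le_one_left (norm_nonneg _) q1
    · change |q • σ| ≤ |σ|
      rw [n2]; exact mul_le_of_le_one_left (abs_nonneg _) q1
    · refine dB _ ((c6 (q • y)).2 ?_) _ le_rfl ?_
      · rw [n1]
        calc q * ‖y‖ ≤ (1 - ζ) * ra |σ| := by gcongr; linarith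
          _ ≤ _ := c7
      · change |q • σ| ≤ abs (T (abs σ))
        rw [n2, abs_of_nonneg c1]; exact G _ hs
  have hv := measureReal_mono (μ := volume) hsub (inter_fin hA B)
  rw [vol_smul D q0.le, vD] at hv
  have bern : 1 - (k * (k + 1)) * ζ ≤ q ^ (k + 1) := by
    rw [hq, ← pow_mul]
    have := one_add_mul_le_pow (a := -ζ) (by linarith) (k * (k + 1))
    push_cast at this
    calc _ = 1 + (k : ℝ) * (k + 1) * -ζ := by ring
      _ ≤ (1 + -ζ) ^ (k * (k + 1)) := this
      _ = _ := by ring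
  refine le_trans ?_ hv
  have e1 : x ^ 2 ≤ x / τ := by
    rw [le_div_iff₀ hτ]; nlinarith
  have e2 : ζ = 2 * (x / τ) := by rw [hζ]; ring
  have e3 : 0 ≤ k * (k + 1) * ζ * (2 * x ^ 2) := by positivity
  calc 1 - (2 * k * (k + 1) + 2) * (x / τ) ≤ 1 - k * (k + 1) * ζ - 2 * x ^ 2 := by
        rw [e2]; linarith
    _ ≤ (1 - k * (k + 1) * ζ) * (1 - 2 * x ^ 2) := by linarith
    _ ≤ _ := by gcongr; linarith

/-- Planar approximate convexity data. -/
structure Planar (PA PB PC : Set (ℝ × ℝ)) (τ t ε θ : ℝ) : Prop where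
  nnA : ∀ z ∈ PA, 0 ≤ z
  nnB : ∀ z ∈ PB, 0 ≤ z
  cA : PC ⊆ PA
  cB : PC ⊆ PB
  clos : IsClosed PC
  down : ∀ z ∈ PC, ∀ w, 0 ≤ w → w ≤ z → w ∈ PC
  τ0 : 0 < τ
  τt : τ ≤ t
  tτ : t ≤ 1 - τ
  ε0 : 0 < ε
  θ0 : 0 < θ
  mem : (θ, θ) ∈ PC
  box : ∀ a ∈ PA, ∀ b ∈ PB, (ε, ε) ≤ t • a + (1 - t) • b → t • a + (1 - t) • b - (ε, ε) ∈ PC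

theorem planar_s1 {PC : Set (ℝ × ℝ)} {τ σ ε θ κ : ℝ}
    (down : ∀ z ∈ PC, ∀ w, 0 ≤ w → w ≤ z → w ∈ PC)
    (τ0 : 0 < τ) (h1 : τ ≤ σ) (h2 : σ ≤ 1 - τ) (ε0 : 0 < ε) (θ0 : 0 < θ) (mem : (θ, θ) ∈ PC)
    {a : ℝ × ℝ} (ha : 0 ≤ a)
    (box : ∀ c ∈ PC, (ε, ε) ≤ σ • a + (1 - σ) • c → σ • a + (1 - σ) • c - (ε, ε) ∈ PC)
    (κ1 : κ ≤ 1) (hκ : τ * κ * θ = 5 * (ε / τ)) :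
    (1 - κ) • a + (4 * (ε / τ), 4 * (ε / τ)) ∈ PC := by
  obtain ⟨a1, a2⟩ := a
  have σ0 : 0 < σ := by linarith
  have hσ1 : 0 < 1 - σ := by linarith
  have ha1 : 0 ≤ a1 := ha.1
  have ha2 : 0 ≤ a2 := ha.2
  have e0 : 0 < ε / τ := by positivity
  have eσ : ε / σ ≤ ε / τ := by gcongr
  have eσ0 : 0 < ε / σ := by positivity
  have κ0 : 0 < κ := by
    by_contra h
    push Not at h
    have : τ * κ * θ ≤ 0 := mul_nonpos_of_nonpos_of_nonneg
      (mul_nonpos_of_nonneg_of_nonpos τ0.le h) θ0.le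
    linarith
  have ind : ∀ j : ℕ, ε / σ ≤ (1 - σ) ^ j * θ →
      ((1 - (1 - σ) ^ j) * a1 + (1 - σ) ^ j * θ - ε / σ * (1 - (1 - σ) ^ j),
       (1 - (1 - σ) ^ j) * a2 + (1 - σ) ^ j * θ - ε / σ * (1 - (1 - σ) ^ j)) ∈ PC := by
    intro j
    induction j with
    | zero => intro _; simpa using mem
    | succ j ih =>
      intro hj
      have l0 : 0 < (1 - σ) ^ j := by positivity
      have l1 : (1 - σ) ^ j ≤ 1 := pow_le_one₀ hσ1.le (by linarith)
      have hj' : (1 - σ) ^ (j + 1) = (1 - σ) * (1 - σ) ^ j := by ring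
      have lt1 : (1 - σ) ^ (j + 1) ≤ (1 - σ) ^ j := by
        rw [hj']; nlinarith
      have hh := ih (hj.trans (by gcongr))
      have hb := box _ hh
      set l := (1 - σ) ^ j with hl
      set l' := (1 - σ) ^ (j + 1) with hl'
      have es : ε / σ * σ = ε := by field_simp
      set E := ε / σ with hE
      have e : ∀ x : ℝ, σ * x + (1 - σ) * ((1 - l) * x + l * θ - E * (1 - l)) =
          ((1 - l') * x + l' * θ - E * (1 - l')) + ε := by
        intro x; rw [hj', ← es]; ring
      have l'1 : l' ≤ 1 := lt1.trans l1
      have l'0 : 0 < l' := by rw [hj']; positivity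
      have g : ∀ x : ℝ, 0 ≤ x → 0 ≤ (1 - l') * x + l' * θ - E * (1 - l') := by
        intro x hx
        have : 0 ≤ (1 - l') * x := mul_nonneg (by linarith) hx
        nlinarith
      simp only [Prod.smul_mk, smul_eq_mul, Prod.mk_add_mk, e, Prod.mk_sub_mk,
        add_sub_cancel_right] at hb
      exact hb ⟨by simpa using g a1 ha1, by simpa using g a2 ha2⟩
  obtain ⟨m, hm1, hm2⟩ := exists_nat_pow_near_of_lt_one κ0 κ1 hσ1 (by linarith)
  have hl : τ * κ ≤ (1 - σ) ^ (m + 1) := by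
    rw [pow_succ']
    exact mul_le_mul (by linarith) hm2 κ0.le hσ1.le
  have hlθ : 5 * (ε / τ) ≤ (1 - σ) ^ (m + 1) * θ := by
    rw [← hκ]; gcongr
  have h := ind (m + 1) (by linarith)
  set l := (1 - σ) ^ (m + 1) with hl'
  have l0 : 0 < l := by positivity
  have g : ∀ x : ℝ, 0 ≤ x → (1 - κ) * x + 4 * (ε / τ) ≤ (1 - l) * x + l * θ - ε / σ * (1 - l) := by
    intro x hx
    have i1 : (1 - κ) * x ≤ (1 - l) * x := by gcongr
    have i2 : ε / σ * (1 - l) ≤ ε / τ := by nlinarith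
    linarith
  refine down _ h _ ⟨?_, ?_⟩ ⟨g a1 ha1, g a2 ha2⟩
  · have : 0 ≤ (1 - κ) * a1 := mul_nonneg (by linarith) ha1
    simp only [Prod.smul_mk, Prod.mk_add_mk, smul_eq_mul, Prod.fst_zero]; linarith
  · have : 0 ≤ (1 - κ) * a2 := mul_nonneg (by linarith) ha2
    simp only [Prod.smul_mk, Prod.mk_add_mk, smul_eq_mul, Prod.snd_zero]; linarith

theorem planar_s2 {PA PB PC : Set (ℝ × ℝ)} {τ t ε θ : ℝ} (H : Planar PA PB PC τ t ε θ)
    {x y : ℝ × ℝ} (hx : x ∈ PC) (hy : y ∈ PC) (hx1 : (ε / τ, ε / τ) ≤ x)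
    (hy1 : (ε / τ, ε / τ) ≤ y) {l : ℝ} (l0 : 0 ≤ l) (l1 : l ≤ 1) :
    l • x + (1 - l) • y - (ε / τ, ε / τ) ∈ PC := by
  obtain ⟨x1, x2⟩ := x
  obtain ⟨y1, y2⟩ := y
  obtain ⟨hx1, hx2⟩ := hx1
  obtain ⟨hy1, hy2⟩ := hy1
  simp only at hx1 hx2 hy1 hy2
  have τ0 := H.τ0
  have τt := H.τt
  have tτ := H.tτ
  have ε0 := H.ε0
  have t0 : 0 < t := by linarith
  have t1 : 0 < 1 - t := by linarith
  have e0 : 0 < ε / τ := by positivity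
  have eτ : ε / τ * τ = ε := by field_simp
  set e := ε / τ with he
  set D := x1 + x2 + y1 + y2 with hD
  have key : ∀ j : ℕ, ∀ l : ℝ, 0 ≤ l → l ≤ 1 →
      (max 0 (l * x1 + (1 - l) * y1 - (e + (1 - τ) ^ j * D)),
       max 0 (l * x2 + (1 - l) * y2 - (e + (1 - τ) ^ j * D))) ∈ PC := by
    intro j
    induction j with
    | zero =>
      intro l l0 l1
      refine H.down _ H.mem _ ⟨le_max_left _ _, le_max_left _ _⟩ ⟨?_, ?_⟩
      · refine max_le H.θ0.le ?_
        have := H.θ0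
        simp only; nlinarith
      · refine max_le H.θ0.le ?_
        have := H.θ0
        simp only; nlinarith
    | succ j ih =>
      intro l l0 l1
      set E := e + (1 - τ) ^ j * D with hE
      have D0 : 0 < D := by rw [hD]; linarith
      have E0 : 0 < E := by
        have : 0 < 1 - τ := by linarith
        positivity
      have hE' : e + (1 - τ) ^ (j + 1) * D = (1 - τ) * E + ε := by
        rw [hE, ← eτ]; ring
      rw [hE']
      rcases le_total t l with hl | hl
      · have m0 : 0 ≤ (l - t) / (1 - t) := div_nonneg (by linarith) t1.le
        have m1 : (l - t) / (1 - t) ≤ 1 := by rw [div_le_one t1]; linarith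
        have hp := ih _ m0 m1
        set m := (l - t) / (1 - t) with hm
        have hmt : m * (1 - t) = l - t := by rw [hm]; field_simp
        have hb := H.box _ (H.cA hx) _ (H.cB hp)
        have g : ∀ u v : ℝ, e ≤ u → e ≤ v → ε ≤ t * u + (1 - t) * max 0 (m * u + (1 - m) * v - E) ∧
            max 0 (l * u + (1 - l) * v - ((1 - τ) * E + ε)) ≤
              t * u + (1 - t) * max 0 (m * u + (1 - m) * v - E) - ε := by
          intro u v hu hv
          have q1 : ε ≤ t * u := by rw [← eτ]; nlinarith
          have q2 : 0 ≤ (1 - t) * max 0 (m * u + (1 - m) * v - E) :=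
            mul_nonneg t1.le (le_max_left _ _)
          have q3 : (1 - t) * (m * u + (1 - m) * v - E) ≤
              (1 - t) * max 0 (m * u + (1 - m) * v - E) :=
            mul_le_mul_of_nonneg_left (le_max_right _ _) t1.le
          refine ⟨by linarith, max_le (by linarith) ?_⟩
          have q4 : (1 - t) * (m * u + (1 - m) * v - E) =
            (l - t) * u + (1 - l) * v - (1 - t) * E := by
            have : (1 - t) * (m * u + (1 - m) * v - E) =
              (m * (1 - t)) * u + ((1 - t) - m * (1 - t)) * v - (1 - t) * E := by ring
            rw [this, hmt]; ring
          have q5 : (1 - t) * E ≤ (1 - τ) * E := by gcongr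
          nlinarith
        refine H.down _ (hb ⟨(g x1 y1 hx1 hy1).1, (g x2 y2 hx2 hy2).1⟩) _
          ⟨le_max_left _ _, le_max_left _ _⟩ ⟨(g x1 y1 hx1 hy1).2, (g x2 y2 hx2 hy2).2⟩
      · have m0 : 0 ≤ l / t := div_nonneg l0 t0.le
        have m1 : l / t ≤ 1 := by rw [div_le_one t0]; linarith
        have hp := ih _ m0 m1
        set m := l / t with hm
        have hmt : m * t = l := by rw [hm]; field_simp
        have hb := H.box _ (H.cA hp) _ (H.cB hy)
        have g : ∀ u v : ℝ, e ≤ u → e ≤ v → ε ≤ t * max 0 (m * u + (1 - m) * v - E) + (1 - t) * v ∧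
            max 0 (l * u + (1 - l) * v - ((1 - τ) * E + ε)) ≤
              t * max 0 (m * u + (1 - m) * v - E) + (1 - t) * v - ε := by
          intro u v hu hv
          have q1 : ε ≤ (1 - t) * v := by rw [← eτ]; nlinarith
          have q2 : 0 ≤ t * max 0 (m * u + (1 - m) * v - E) :=
            mul_nonneg t0.le (le_max_left _ _)
          have q3 : t * (m * u + (1 - m) * v - E) ≤
              t * max 0 (m * u + (1 - m) * v - E) :=
            mul_le_mul_of_nonneg_left (le_max_right _ _) t0.le
          refine ⟨by linarith, max_le (by linarith) ?_⟩
          have q4 : t * (m * u + (1 - m) * v - E) = l * u + (t - l) * v - t * E := by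
            have : t * (m * u + (1 - m) * v - E) =
              (m * t) * u + (t - m * t) * v - t * E := by ring
            rw [this, hmt]
          have q5 : t * E ≤ (1 - τ) * E := by gcongr
          nlinarith
        refine H.down _ (hb ⟨(g x1 y1 hx1 hy1).1, (g x2 y2 hx2 hy2).1⟩) _
          ⟨le_max_left _ _, le_max_left _ _⟩ ⟨(g x1 y1 hx1 hy1).2, (g x2 y2 hx2 hy2).2⟩
  have tend : Filter.Tendsto (fun j : ℕ => (1 - τ) ^ j) Filter.atTop (nhds 0) :=
    tendsto_pow_atTop_nhds_zero_of_lt_one (by linarith) (by linarith)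
  have tc : ∀ w : ℝ, 0 ≤ w - e → Filter.Tendsto (fun j : ℕ => max 0 (w - (e + (1 - τ) ^ j * D)))
      Filter.atTop (nhds (w - e)) := by
    intro w hw
    have h := (((tend.mul_const D).const_add e).const_sub w)
    have h2 := (tendsto_const_nhds (x := (0 : ℝ))).max h
    simpa [max_eq_right hw] using h2
  have g1 : 0 ≤ l * x1 + (1 - l) * y1 - e := by nlinarith
  have g2 : 0 ≤ l * x2 + (1 - l) * y2 - e := by nlinarith
  exact H.clos.mem_of_tendsto ((tc _ g1).prodMk_nhds (tc _ g2))
    (Filter.Eventually.of_forall fun j => key j l l0 l1)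

theorem planar_hull {PA PB PC : Set (ℝ × ℝ)} {τ t ε θ κ : ℝ} (H : Planar PA PB PC τ t ε θ)
    (κ1 : κ ≤ 1) (hκ : τ * κ * θ = 5 * (ε / τ)) {z : ℝ × ℝ} (hz : z ∈ convexHull ℝ (PA ∪ PB)) :
    (1 - κ) • z ∈ PC := by
  have τ0 := H.τ0
  have ε0 := H.ε0
  have e0 : 0 < ε / τ := by positivity
  have nn : ∀ a ∈ PA ∪ PB, (0 : ℝ × ℝ) ≤ a := by
    rintro a (ha | ha)
    · exact H.nnA a ha
    · exact H.nnB a ha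
  have hull_nn : ∀ s : Finset (ℝ × ℝ), (s : Set (ℝ × ℝ)) ⊆ PA ∪ PB →
      ∀ z ∈ convexHull ℝ (s : Set (ℝ × ℝ)), (0 : ℝ × ℝ) ≤ z := by
    intro s hs z hz
    exact convexHull_min (fun a ha => nn a (hs ha)) (convex_Ici (𝕜 := ℝ) (0 : ℝ × ℝ)) hz
  have s1 : ∀ a ∈ PA ∪ PB, (1 - κ) • a + (4 * (ε / τ), 4 * (ε / τ)) ∈ PC := by
    rintro a (ha | ha)
    · exact planar_s1 H.down τ0 H.τt H.tτ ε0 H.θ0 H.mem (H.nnA a ha)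
        (fun c hc h => H.box a ha c (H.cB hc) h) κ1 hκ
    · refine planar_s1 H.down τ0 (σ := 1 - t) (by linarith [H.tτ]) (by linarith [H.τt]) ε0 H.θ0
        H.mem (H.nnB a ha) (fun c hc h => ?_) κ1 hκ
      have hh := H.box c (H.cA hc) a ha
      rw [sub_sub_cancel, add_comm] at h ⊢
      exact hh h
  set e := ε / τ with he
  have ind : ∀ s : Finset (ℝ × ℝ), s.Nonempty → (s : Set (ℝ × ℝ)) ⊆ PA ∪ PB → s.card ≤ 3 →
      ∀ z ∈ convexHull ℝ (s : Set (ℝ × ℝ)),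
        (1 - κ) • z + ((5 - s.card) * e, (5 - s.card) * e) ∈ PC := by
    intro s hs
    induction hs using Finset.Nonempty.cons_induction with
    | singleton a =>
      intro hs _ z hz
      simp only [Finset.coe_singleton, convexHull_singleton, mem_singleton_iff] at hz
      subst hz
      have := s1 z (hs (by simp))
      rw [Finset.card_singleton]
      norm_num
      exact this
    | cons a s ha hs ih =>
      intro hsub hcard z hz
      rw [Finset.card_cons] at hcard ⊢
      rw [Finset.coe_cons] at hsub hz
      have hsub' := (subset_insert a (s : Set (ℝ × ℝ))).trans hsub
      rw [convexHull_insert (by exact_mod_cast hs)] at hz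
      obtain ⟨a', ha', w, hw, hz⟩ := mem_convexJoin.1 hz
      rw [mem_singleton_iff.1 ha'] at hz
      obtain ⟨l, l', l0, l0', hl, rfl⟩ := hz
      have hl' : l' = 1 - l := by linarith
      subst hl'
      have c1 : (1 : ℝ) ≤ s.card := by exact_mod_cast hs.card_pos
      have c2 : (s.card : ℝ) + 1 ≤ 3 := by exact_mod_cast hcard
      have hw' := ih hsub' (by omega) w hw
      have haP := nn a (hsub (mem_insert _ _))
      have hwP := hull_nn s hsub' w hw
      have n1 : (0 : ℝ × ℝ) ≤ (1 - κ) • a := smul_nonneg (by linarith) haP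
      have n2 : (0 : ℝ × ℝ) ≤ (1 - κ) • w := smul_nonneg (by linarith) hwP
      have c3 : e ≤ (5 - s.card) * e := by nlinarith
      have c4 : (5 - s.card) * e ≤ 4 * e := by nlinarith
      have v1 : (e, e) ≤ (1 - κ) • a + ((5 - s.card) * e, (5 - s.card) * e) :=
        le_trans (show (e, e) ≤ ((5 - s.card) * e, (5 - s.card) * e) from ⟨c3, c3⟩)
          (le_add_of_nonneg_left n1)
      have v2 : (e, e) ≤ (1 - κ) • w + ((5 - s.card) * e, (5 - s.card) * e) :=
        le_trans (show (e, e) ≤ ((5 - s.card) * e, (5 - s.card) * e) from ⟨c3, c3⟩)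
          (le_add_of_nonneg_left n2)
      have ha2 : (1 - κ) • a + ((5 - s.card) * e, (5 - s.card) * e) ∈ PC := by
        refine H.down _ (s1 a (hsub (mem_insert _ _))) _
          (le_trans (show (0 : ℝ × ℝ) ≤ (e, e) from ⟨e0.le, e0.le⟩) v1) ?_
        gcongr
      have := planar_s2 H ha2 hw' v1 v2 l0 (by linarith)
      convert this using 1
      ext
      · simp; ring
      · simp; ring
  rw [convexHull_eq_union] at hz
  simp only [mem_iUnion] at hz
  obtain ⟨s, hs, hai, hz⟩ := hz
  have hne : s.Nonempty := by
    rw [← Finset.coe_nonempty, ← convexHull_nonempty_iff (𝕜 := ℝ)]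
    exact ⟨z, hz⟩
  have hc : s.card ≤ 3 := by
    have h1 := hai.card_le_finrank_succ
    have h2 := Submodule.finrank_le (vectorSpan ℝ (range ((↑) : s → ℝ × ℝ)))
    simp at h1 h2
    omega
  have h := ind s hne hs hc z hz
  have zn := hull_nn s hs z hz
  have n2 : (0 : ℝ × ℝ) ≤ (1 - κ) • z := smul_nonneg (by linarith) zn
  refine H.down _ h _ n2 (le_add_of_nonneg_right ?_)
  have c2 : (s.card : ℝ) ≤ 3 := by exact_mod_cast hc
  have : 0 ≤ (5 - s.card) * e := by nlinarith
  exact ⟨this, this⟩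

/-- Profile of a rotationally symmetric set. -/
def prof {k : ℕ} (u : EuclideanSpace ℝ (Fin k)) (X : Set (EuclideanSpace ℝ (Fin k) × ℝ)) :
    Set (ℝ × ℝ) := {z | 0 ≤ z ∧ (z.1 • u, z.2) ∈ X}

/-- The profile map. -/
noncomputable def profMap {k : ℕ} (p : EuclideanSpace ℝ (Fin k) × ℝ) : ℝ × ℝ := (‖p.1‖, |p.2|)

/-- The convex set containing both sets. -/
def hullK {k : ℕ} (A B : Set (EuclideanSpace ℝ (Fin k) × ℝ)) :
    Set (EuclideanSpace ℝ (Fin k) × ℝ) :=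
  {p | ∃ z ∈ convexHull ℝ (profMap '' (A ∪ B)), ‖p.1‖ ≤ z.1 ∧ |p.2| ≤ z.2}

theorem hullK_convex {k : ℕ} (A B : Set (EuclideanSpace ℝ (Fin k) × ℝ)) :
    Convex ℝ (hullK A B) := by
  rintro p ⟨z, hz, h1, h2⟩ p' ⟨z', hz', h1', h2'⟩ a b ha hb hab
  refine ⟨a • z + b • z', convex_convexHull ℝ _ hz hz' ha hb hab, ?_, ?_⟩
  · change ‖a • p.1 + b • p'.1‖ ≤ a * z.1 + b * z'.1
    refine (norm_add_le _ _).trans ?_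
    rw [norm_smul, norm_smul, Real.norm_of_nonneg ha, Real.norm_of_nonneg hb]
    gcongr
  · change |a * p.2 + b * p'.2| ≤ a * z.2 + b * z'.2
    refine (abs_add_le _ _).trans ?_
    rw [abs_mul, abs_mul, abs_of_nonneg ha, abs_of_nonneg hb]
    gcongr

theorem subset_hullK {k : ℕ} (A B : Set (EuclideanSpace ℝ (Fin k) × ℝ)) :
    A ∪ B ⊆ hullK A B := fun p hp =>
  ⟨profMap p, subset_convexHull ℝ _ (mem_image_of_mem _ hp), le_rfl, le_rfl⟩

theorem down_inter {k : ℕ} {A B : Set (EuclideanSpace ℝ (Fin k) × ℝ)} (dA : DownSet A)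
    (dB : DownSet B) : DownSet (A ∩ B) :=
  fun p hp w h1 h2 => ⟨dA p hp.1 w h1 h2, dB p hp.2 w h1 h2⟩

theorem norm_smul_unit {k : ℕ} {u : EuclideanSpace ℝ (Fin k)} (hu : ‖u‖ = 1) {r : ℝ}
    (hr : 0 ≤ r) : ‖r • u‖ = r := by
  rw [norm_smul, hu, Real.norm_of_nonneg hr, mul_one]

theorem prof_mem {k : ℕ} {u : EuclideanSpace ℝ (Fin k)} (hu : ‖u‖ = 1)
    {X : Set (EuclideanSpace ℝ (Fin k) × ℝ)} (hd : DownSet X)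
    {p : EuclideanSpace ℝ (Fin k) × ℝ} (hp : p ∈ X) {z : ℝ × ℝ} (hz : 0 ≤ z)
    (h1 : z.1 ≤ ‖p.1‖) (h2 : z.2 ≤ |p.2|) : z ∈ prof u X := by
  refine ⟨hz, hd p hp _ ?_ ?_⟩
  · change ‖z.1 • u‖ ≤ ‖p.1‖
    rwa [norm_smul_unit hu hz.1]
  · change |z.2| ≤ |p.2|
    rwa [abs_of_nonneg hz.2]

theorem prof_mem' {k : ℕ} {u : EuclideanSpace ℝ (Fin k)} (hu : ‖u‖ = 1)
    {X : Set (EuclideanSpace ℝ (Fin k) × ℝ)} (hd : DownSet X)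
    {p : EuclideanSpace ℝ (Fin k) × ℝ} {z : ℝ × ℝ} (hz : z ∈ prof u X)
    (h1 : ‖p.1‖ ≤ z.1) (h2 : |p.2| ≤ z.2) : p ∈ X := by
  refine hd _ hz.2 _ ?_ ?_
  · change ‖p.1‖ ≤ ‖z.1 • u‖
    rwa [norm_smul_unit hu hz.1.1]
  · change |p.2| ≤ |z.2|
    rwa [abs_of_nonneg hz.1.2]

theorem prof_box {k : ℕ} {A B : Set (EuclideanSpace ℝ (Fin k) × ℝ)}
    (hA : IsCompact A) (hB : IsCompact B) (dA : DownSet A) (dB : DownSet B)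
    {t ε : ℝ} (t0 : 0 < t) (t1 : t < 1) (ε0 : 0 < ε)
    {u : EuclideanSpace ℝ (Fin k)} (hu : ‖u‖ = 1)
    (hvol : volume.real (t • A + (1 - t) • B) <
      volume.real (A ∩ B) + (ε / 2) ^ k * omegaBall k * ε)
    {a b : ℝ × ℝ} (ha : a ∈ prof u A) (hb : b ∈ prof u B)
    (h : (ε, ε) ≤ t • a + (1 - t) • b) :
    t • a + (1 - t) • b - (ε, ε) ∈ prof u (A ∩ B) := by
  set w := t • a + (1 - t) • b with hw
  obtain ⟨w1, w2⟩ := w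
  have e1 : w1 = t * a.1 + (1 - t) * b.1 := congrArg Prod.fst hw
  have e2 : w2 = t * a.2 + (1 - t) * b.2 := congrArg Prod.snd hw
  have h1 : ε ≤ w1 := h.1
  have h2 : ε ≤ w2 := h.2
  by_contra hcon
  set Q := Metric.closedBall ((w1 - ε / 2) • u) (ε / 2) ×ˢ Icc (w2 - ε) w2 with hQ
  have cS := compactS hA hB t
  have hCS : A ∩ B ⊆ t • A + (1 - t) • B := fun p hp =>
    memS dA dB t0 t1 hp.1 hp.2 (by linarith) (by linarith)
  have hQS : Q ⊆ t • A + (1 - t) • B := by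
    rintro ⟨y, σ⟩ ⟨hy, hσ⟩
    have hy : y ∈ Metric.closedBall ((w1 - ε / 2) • u) (ε / 2) := hy
    have hσ : w2 - ε ≤ σ ∧ σ ≤ w2 := hσ
    rw [mem_closedBall_iff_norm] at hy
    refine memS dA dB t0 t1 ha.2 hb.2 ?_ ?_
    · change ‖y‖ ≤ t * ‖a.1 • u‖ + (1 - t) * ‖b.1 • u‖
      rw [norm_smul_unit hu ha.1.1, norm_smul_unit hu hb.1.1, ← e1]
      have h3 := norm_le_norm_add_norm_sub' y ((w1 - ε / 2) • u)
      rw [norm_smul_unit hu (by linarith)] at h3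
      linarith
    · change |σ| ≤ t * |a.2| + (1 - t) * |b.2|
      rw [abs_of_nonneg ha.1.2, abs_of_nonneg hb.1.2, ← e2, abs_of_nonneg (by linarith)]
      exact hσ.2
  have hdis : Disjoint Q (A ∩ B) := by
    rw [Set.disjoint_left]
    rintro ⟨y, σ⟩ ⟨hy, hσ⟩ hC
    have hy : y ∈ Metric.closedBall ((w1 - ε / 2) • u) (ε / 2) := hy
    have hσ : w2 - ε ≤ σ ∧ σ ≤ w2 := hσ
    rw [mem_closedBall_iff_norm] at hy
    refine hcon (prof_mem hu (down_inter dA dB) hC ⟨?_, ?_⟩ ?_ ?_)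
    · change 0 ≤ w1 - ε; linarith
    · change 0 ≤ w2 - ε; linarith
    · change w1 - ε ≤ ‖y‖
      have h3 := norm_le_norm_add_norm_sub y ((w1 - ε / 2) • u)
      rw [norm_smul_unit hu (by linarith)] at h3
      linarith
    · change w2 - ε ≤ |σ|
      exact hσ.1.trans (le_abs_self _)
  have h4 := measureReal_mono (μ := volume) (union_subset hQS hCS) cS.measure_lt_top.ne
  rw [measureReal_union hdis (hA.inter hB).measurableSet (box_fin _ _ _ _)
    (inter_fin hA B), box_real _ (by linarith), Real.volume_real_Icc_of_le (by linarith)] at h4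
  have : w2 - (w2 - ε) = ε := by ring
  rw [this] at h4
  linarith

theorem theta_mem {k : ℕ} (hk : 1 ≤ k) {A C : Set (EuclideanSpace ℝ (Fin k) × ℝ)}
    (hA : IsCompact A) (dA : DownSet A) (dC : DownSet C) (hCA : C ⊆ A)
    {u : EuclideanSpace ℝ (Fin k)} (hu : ‖u‖ = 1) {L θ : ℝ} (L0 : 0 ≤ L)
    (hL1 : volume (Prod.fst '' A) ≤ ENNReal.ofReal L) (hL2 : volume (hfiber A 0) ≤ ENNReal.ofReal L)
    (θ0 : 0 < θ) (θ1 : θ ≤ 1) (hθ : θ * L * (omegaBall k + 2) < 1 / 2)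
    (hC : 1 / 2 ≤ volume.real C) : (θ, θ) ∈ prof u C := by
  have hω := omegaBall_pos k
  have hne : C.Nonempty := by
    by_contra h
    rw [not_nonempty_iff_eq_empty] at h
    subst h; simp at hC; linarith
  have hneA := hne.mono hCA
  obtain ⟨p, hp, hpm⟩ := hA.exists_isMaxOn hneA (f := fun p => ‖p.1‖) continuous_fst.norm.continuousOn
  obtain ⟨p', hp', hpm'⟩ := hA.exists_isMaxOn hneA (f := fun p => |p.2|) continuous_snd.abs.continuousOn
  have b1 : ‖p.1‖ ^ k * omegaBall k ≤ L := by
    rw [← ball_real (0 : EuclideanSpace ℝ (Fin k)) (norm_nonneg _)]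
    refine ENNReal.toReal_le_of_le_ofReal L0 (le_trans (measure_mono ?_) hL1)
    intro y hy
    rw [mem_closedBall_zero_iff] at hy
    exact ⟨(y, 0), dA p hp _ hy (by simp), rfl⟩
  have b2 : 2 * |p'.2| ≤ L := by
    have : volume.real (Icc (-|p'.2|) |p'.2|) = 2 * |p'.2| := by
      rw [Real.volume_real_Icc_of_le (by linarith [abs_nonneg p'.2])]; ring
    rw [← this]
    refine ENNReal.toReal_le_of_le_ofReal L0 (le_trans (measure_mono ?_) hL2)
    intro s hs
    exact dA p' hp' _ (by simp) (abs_le.2 hs)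
  by_contra hcon
  have hsub : C ⊆ (Metric.closedBall 0 θ ×ˢ Icc (-|p'.2|) |p'.2|) ∪
      (Metric.closedBall 0 ‖p.1‖ ×ˢ Icc (-θ) θ) := by
    rintro ⟨y, s⟩ h
    rcases le_total ‖y‖ θ with h1 | h1
    · left
      exact ⟨by simpa using h1, abs_le.1 (hpm' (hCA h))⟩
    · right
      refine ⟨by simpa using hpm (hCA h), abs_le.1 ?_⟩
      by_contra h2
      push Not at h2
      exact hcon (prof_mem hu dC h ⟨θ0.le, θ0.le⟩ h1 h2.le)
  have h3 := measureReal_mono (μ := volume) hsub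
    (measure_union_ne_top (box_fin _ _ _ _) (box_fin _ _ _ _))
  have h4 := h3.trans (measureReal_union_le _ _)
  rw [box_real _ θ0.le, box_real _ (norm_nonneg _),
    Real.volume_real_Icc_of_le (by linarith [abs_nonneg p'.2]),
    Real.volume_real_Icc_of_le (by linarith)] at h4
  have h5 : θ ^ k ≤ θ := pow_le_of_le_one θ0.le θ1 (by omega)
  have h6 : θ ^ k * omegaBall k * (|p'.2| - -|p'.2|) ≤ θ * omegaBall k * L := by
    gcongr
    · linarith [abs_nonneg p'.2]
    · linarith
  have h7 : ‖p.1‖ ^ k * omegaBall k * (θ - -θ) ≤ L * (2 * θ) := by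
    have : θ - -θ = 2 * θ := by ring
    rw [this]; gcongr
  nlinarith

theorem partII {k : ℕ} (hk : 1 ≤ k) {A B : Set (EuclideanSpace ℝ (Fin k) × ℝ)}
    (hA : IsCompact A) (hB : IsCompact B) (dA : DownSet A) (dB : DownSet B)
    {τ t ε θ κ L : ℝ} (hτ : 0 < τ) (ht : τ ≤ t) (ht1 : t ≤ 1 - τ) (ε0 : 0 < ε)
    (hvol : volume.real (t • A + (1 - t) • B) <
      volume.real (A ∩ B) + (ε / 2) ^ k * omegaBall k * ε) (L0 : 0 ≤ L)
    (hL1 : volume (Prod.fst '' A) ≤ ENNReal.ofReal L) (hL2 : volume (hfiber A 0) ≤ ENNReal.ofReal L)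
    (θ0 : 0 < θ) (θ1 : θ ≤ 1) (hθ : θ * L * (omegaBall k + 2) < 1 / 2)
    (hC : 1 / 2 ≤ volume.real (A ∩ B)) (hC2 : volume.real (A ∩ B) ≤ 2)
    (κ1 : (k + 1) * κ ≤ 1 / 2) (κ0 : 0 ≤ κ) (hκ : τ * κ * θ = 5 * (ε / τ)) :
    volume (hullK A B \ (A ∩ B)) ≤ ENNReal.ofReal (4 * (k + 1) * κ) := by
  have t0 : 0 < t := by linarith
  have t1 : t < 1 := by linarith
  obtain ⟨u, hu⟩ : ∃ u : EuclideanSpace ℝ (Fin k), ‖u‖ = 1 :=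
    ⟨EuclideanSpace.single (⟨0, hk⟩ : Fin k) (1 : ℝ), by simp⟩
  have dC := down_inter dA dB
  have cC := hA.inter hB
  have H : Planar (prof u A) (prof u B) (prof u (A ∩ B)) τ t ε θ :=
    { nnA := fun z hz => hz.1
      nnB := fun z hz => hz.1
      cA := fun z hz => ⟨hz.1, hz.2.1⟩
      cB := fun z hz => ⟨hz.1, hz.2.2⟩
      clos := by
        refine isClosed_Ici.inter (cC.isClosed.preimage ?_)
        fun_prop
      down := by
        intro z hz w hw hwz
        refine prof_mem hu dC hz.2 hw ?_ ?_
        · change w.1 ≤ ‖z.1 • u‖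
          rw [norm_smul_unit hu hz.1.1]; exact hwz.1
        · exact hwz.2.trans (le_abs_self _)
      τ0 := hτ
      τt := ht
      tτ := ht1
      ε0 := ε0
      θ0 := θ0
      mem := theta_mem hk hA dA dC inter_subset_left hu L0 hL1 hL2 θ0 θ1 hθ hC
      box := fun a ha b hb h => prof_box hA hB dA dB t0 t1 ε0 hu hvol ha hb h }
  have k1 : (1 : ℝ) ≤ k := by exact_mod_cast hk
  have κ1' : κ ≤ 1 / 2 := by nlinarith
  have q0 : 0 < 1 - κ := by linarith
  have sub : profMap '' (A ∪ B) ⊆ prof u A ∪ prof u B := by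
    rintro _ ⟨p, hp | hp, rfl⟩
    · left; exact prof_mem hu dA hp ⟨norm_nonneg _, abs_nonneg _⟩ le_rfl le_rfl
    · right; exact prof_mem hu dB hp ⟨norm_nonneg _, abs_nonneg _⟩ le_rfl le_rfl
  have hK : hullK A B ⊆ (1 - κ)⁻¹ • (A ∩ B) := by
    rintro p ⟨z, hz, h1, h2⟩
    have hz' := planar_hull H (by linarith) hκ (convexHull_mono sub hz)
    rw [mem_smul_set_iff_inv_smul_mem₀ (inv_ne_zero q0.ne'), inv_inv]
    refine prof_mem' hu dC hz' ?_ ?_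
    · change ‖(1 - κ) • p.1‖ ≤ (1 - κ) * z.1
      rw [norm_smul, Real.norm_of_nonneg q0.le]; gcongr
    · change |(1 - κ) * p.2| ≤ (1 - κ) * z.2
      rw [abs_mul, abs_of_pos q0]; gcongr
  have cK : volume ((1 - κ)⁻¹ • (A ∩ B)) ≠ ⊤ := (cC.smul _).measure_lt_top.ne
  have fK : volume (hullK A B) ≠ ⊤ := ne_top_of_le_ne_top cK (measure_mono hK)
  have hv := measureReal_mono (μ := volume) hK cK
  rw [vol_smul _ (inv_nonneg.2 q0.le)] at hv
  have hCK : A ∩ B ⊆ hullK A B := fun p hp => subset_hullK A B (Or.inl hp.1)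
  have hd := measureReal_sdiff (μ := volume) hCK cC.measurableSet fK
  have fin : volume (hullK A B \ (A ∩ B)) ≠ ⊤ := ne_top_of_le_ne_top fK (measure_mono sdiff_subset)
  refine (ENNReal.le_ofReal_iff_toReal_le fin (by positivity)).2 ?_
  change volume.real (hullK A B \ (A ∩ B)) ≤ _
  rw [hd]
  have bern : 1 - (k + 1) * κ ≤ (1 - κ) ^ (k + 1) := by
    have := one_add_mul_le_pow (a := -κ) (by linarith) (k + 1)
    push_cast at this
    calc _ = 1 + ((k : ℝ) + 1) * -κ := by ring
      _ ≤ (1 + -κ) ^ (k + 1) := this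
      _ = _ := by ring
  have inv : ((1 - κ)⁻¹) ^ (k + 1) ≤ 1 + 2 * ((k + 1) * κ) := by
    rw [inv_pow]
    have pos : (0 : ℝ) < 1 - (k + 1) * κ := by linarith
    refine (inv_anti₀ pos bern).trans ?_
    rw [inv_le_iff_one_le_mul₀ pos]
    have : 0 ≤ (k + 1) * κ := by positivity
    nlinarith
  have c0 : 0 ≤ volume.real (A ∩ B) := by linarith
  have m0 : 0 ≤ 2 * ((k + 1) * κ) := by positivity
  nlinarith [mul_le_mul_of_nonneg_right inv c0, mul_le_mul_of_nonneg_left hC2 m0]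

set_option maxHeartbeats 1000000 in
theorem core (k n : ℕ) (hk : 1 ≤ k) (hn : n = k + 1) (M : ℝ) (hM : 1 < M) :
    ∃ c : ℝ, 1 ≤ c ∧ ∀ (A B : Set (EuclideanSpace ℝ (Fin k) × ℝ)) (τ t g : ℝ),
      IsCompact A → IsCompact B → DownSet A → DownSet B →
      0 < τ → τ ≤ 1 / 2 → τ ≤ t → t ≤ 1 - τ →
      volume (Prod.fst '' A) ≤ ENNReal.ofReal (M / τ ^ (2 * n)) →
      volume (hfiber A 0) ≤ ENNReal.ofReal (M / τ ^ (2 * n)) →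
      0 < g → c * g ≤ τ ^ (2 * n + 3) →
      |volume.real A - 1| ≤ g ^ (4 * n) → |volume.real B - 1| ≤ g ^ (4 * n) →
      |volume.real (t • A + (1 - t) • B) - 1| ≤ g ^ (4 * n) →
      volume (symmDiff A B) ≤ ENNReal.ofReal (c * g ^ n / τ ^ (2 * n + 3)) ∧
      volume (hullK A B \ A) + volume (hullK A B \ B) ≤
        ENNReal.ofReal (c * g / τ ^ (2 * n + 3)) := by
  have hω := omegaBall_pos k
  set ω := omegaBall k with hωd
  set c1 : ℝ := 2 * k * (k + 1) + 2 with hc1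
  have c1p : 2 ≤ c1 := by rw [hc1]; have : (0 : ℝ) ≤ 2 * k * (k + 1) := by positivity
                          linarith
  set c3 : ℝ := 1 + 2 ^ k * (c1 + 1) / ω with hc3
  have c3p : 1 ≤ c3 := by
    rw [hc3]
    have : 0 ≤ 2 ^ k * (c1 + 1) / ω := by positivity
    linarith
  set c4 : ℝ := 4 * M * (ω + 2) with hc4
  have c4p : 1 ≤ c4 := by rw [hc4]; nlinarith
  set c : ℝ := 4 + 2 * (c1 + 1) + 40 * (k + 1) * c3 * c4 with hc
  have c34 : 0 < 40 * (k + 1) * c3 * c4 := by positivity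
  refine ⟨c, by rw [hc]; linarith, ?_⟩
  intro A B τ t g hA hB dA dB τ0 τ2 ht ht1 hL1 hL2 g0 hg vA vB vS
  have τ1 : τ ≤ 1 := by linarith
  set P := τ ^ (2 * n + 3) with hP
  have P0 : 0 < P := by positivity
  have Pτ : P ≤ τ := pow_le_of_le_one τ0.le τ1 (by omega)
  have cp : 0 < c := by rw [hc]; linarith
  have hg1 : g ≤ τ / 4 := by
    have : 4 * g ≤ c * g := by gcongr; rw [hc]; linarith
    linarith
  have hg2 : 2 * c1 * g ≤ τ := by
    have : 2 * c1 * g ≤ c * g := by gcongr; rw [hc]; linarith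
    linarith
  have g1 : g ≤ 1 := by linarith
  set x := g ^ n with hx
  have x0 : 0 < x := by positivity
  have xg : x ≤ g := pow_le_of_le_one g0.le g1 (by omega)
  have x4 : g ^ (4 * n) = x ^ 4 := by rw [hx, ← pow_mul, mul_comm]
  rw [x4] at vA vB vS
  have vA := abs_le.1 vA
  have vB := abs_le.1 vB
  have vS := abs_le.1 vS
  have x41 : x ^ 4 ≤ x := pow_le_of_le_one x0.le (by linarith) (by norm_num)
  have hI := partI hk hA hB dA dB τ0 τ2 ht ht1 x0 (by linarith) (by linarith) (by linarith)
    (by linarith)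
  rw [← hc1] at hI
  have xτ : x ≤ x / τ := by rw [le_div_iff₀ τ0]; nlinarith
  have hC : 1 / 2 ≤ volume.real (A ∩ B) := by
    have : c1 * (x / τ) ≤ 1 / 2 := by
      rw [← mul_div_assoc, div_le_iff₀ τ0]; nlinarith
    linarith
  have hCA := measureReal_mono (μ := volume) (inter_subset_left (s := A) (t := B))
    hA.measure_lt_top.ne
  have cC := hA.inter hB
  constructor
  · have d1 := measureReal_sdiff (μ := volume) (inter_subset_left (s := A) (t := B))
      cC.measurableSet hA.measure_lt_top.ne
    have d2 := measureReal_sdiff (μ := volume) (inter_subset_right (s := A) (t := B))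
      cC.measurableSet hB.measure_lt_top.ne
    rw [sdiff_self_inter] at d1
    rw [inter_comm, sdiff_self_inter, inter_comm] at d2
    have fA : volume (A \ B) ≠ ⊤ := ne_top_of_le_ne_top hA.measure_lt_top.ne (measure_mono sdiff_subset)
    have fB : volume (B \ A) ≠ ⊤ := ne_top_of_le_ne_top hB.measure_lt_top.ne (measure_mono sdiff_subset)
    have f : volume (symmDiff A B) ≠ ⊤ := by
      rw [Set.symmDiff_def]; exact measure_union_ne_top fA fB
    refine (ENNReal.le_ofReal_iff_toReal_le f (by positivity)).2 ?_
    change volume.real (symmDiff A B) ≤ _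
    rw [Set.symmDiff_def]
    refine (measureReal_union_le _ _).trans ?_
    rw [d1, d2]
    calc _ ≤ 2 * (c1 + 1) * (x / τ) := by linarith
      _ ≤ c * (x / P) := by
        gcongr
        rw [hc]; linarith
      _ = c * x / P := by ring
  · set ε := c3 * g / τ with hε
    have ε0 : 0 < ε := by positivity
    set L := M / τ ^ (2 * n) with hL
    have L0 : 0 < L := by positivity
    set θ := τ ^ (2 * n) / c4 with hθ
    have θ0 : 0 < θ := by positivity
    have θ1 : θ ≤ 1 := by
      rw [hθ, div_le_one (by positivity)]
      exact (pow_le_one₀ τ0.le τ1).trans c4p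
    set κ := 5 * c3 * c4 * g / P with hκ
    have κ0 : 0 ≤ κ := by positivity
    have κ1 : (k + 1) * κ ≤ 1 / 2 := by
      rw [hκ, ← mul_div_assoc, div_le_iff₀ P0]
      have : 10 * (k + 1) * c3 * c4 * g ≤ c * g := by
        gcongr; rw [hc]; linarith
      linarith
    have hθL : θ * L * (ω + 2) < 1 / 2 := by
      have : θ * L * (ω + 2) = 1 / 4 := by
        rw [hθ, hL, hc4]; field_simp
      linarith
    have hκe : τ * κ * θ = 5 * (ε / τ) := by
      rw [hκ, hθ, hε, hP, pow_add]; field_simp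
    have hvol : volume.real (t • A + (1 - t) • B) <
        volume.real (A ∩ B) + (ε / 2) ^ k * ω * ε := by
      have e1 : (ε / 2) ^ k * ω * ε = ω / 2 ^ k * (c3 ^ n * (g ^ n / τ ^ n)) := by
        rw [hε, hn, pow_succ c3, pow_succ g, pow_succ τ, div_pow, div_pow, mul_pow]
        field_simp
      have e2 : c3 * (x / τ) ≤ c3 ^ n * (g ^ n / τ ^ n) := by
        gcongr
        · exact le_self_pow₀ c3p (by omega)
        · exact pow_le_of_le_one τ0.le τ1 (by omega)
      have e3 : ω / 2 ^ k * (c3 * (x / τ)) = (ω / 2 ^ k + (c1 + 1)) * (x / τ) := by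
        rw [hc3]; field_simp
      have e4 : 0 < ω / 2 ^ k * (x / τ) := by positivity
      have e5 : ω / 2 ^ k * (c3 * (x / τ)) ≤ ω / 2 ^ k * (c3 ^ n * (g ^ n / τ ^ n)) := by
        gcongr
      rw [e1]
      rw [e3] at e5
      linarith
    have h := partII hk hA hB dA dB τ0 ht ht1 ε0 hvol L0.le hL1 hL2 θ0 θ1 hθL hC (by linarith)
      κ1 κ0 hκe
    calc _ ≤ volume (hullK A B \ (A ∩ B)) + volume (hullK A B \ (A ∩ B)) := by
          gcongr
          · exact inter_subset_left
          · exact inter_subset_right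
      _ ≤ ENNReal.ofReal (4 * (k + 1) * κ) + ENNReal.ofReal (4 * (k + 1) * κ) := by gcongr
      _ = ENNReal.ofReal (4 * (k + 1) * κ + 4 * (k + 1) * κ) :=
          (ENNReal.ofReal_add (by positivity) (by positivity)).symm
      _ ≤ _ := by
          apply ENNReal.ofReal_le_ofReal
          calc 4 * (k + 1) * κ + 4 * (k + 1) * κ = 40 * (k + 1) * c3 * c4 * g / P := by
                rw [hκ]; ring
            _ ≤ c * g / P := by gcongr; rw [hc]; linarith

theorem beta_bounds {n : ℕ} (hn : 2 ≤ n) {τ : ℝ} (τ0 : 0 < τ) (τ2 : τ ≤ 1 / 2) :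
    0 < τ / (16 * ((n : ℝ) - 1) * |Real.log τ|) ∧
      τ / (16 * ((n : ℝ) - 1) * |Real.log τ|) ≤ 1 / 16 := by
  have n2 : (2 : ℝ) ≤ n := by exact_mod_cast hn
  have hl : 1 / 2 ≤ |Real.log τ| := by
    have h1 : Real.log τ ≤ Real.log (1 / 2) := Real.log_le_log τ0 τ2
    have h2 : Real.log (1 / 2) = -Real.log 2 := by rw [one_div, Real.log_inv]
    have h3 := Real.log_two_gt_d9
    rw [abs_of_neg (by linarith)]; linarith
  have h8 : 8 ≤ 16 * ((n : ℝ) - 1) * |Real.log τ| := by nlinarith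
  refine ⟨by positivity, ?_⟩
  rw [div_le_iff₀ (by linarith)]; linarith

set_option maxHeartbeats 1000000 in
/-- Theorem `main` in the `♮`-symmetric case: if `A = A^♮`, `B = B^♮`
are `(M, τ)`-normalized compact sets with
`||A|-1| + ||B|-1| + ||tA+(1-t)B|-1| ≤ δ ≤ exp(-τ^{-Nₙ})`, then up to a translation
there is a convex set `K ⊇ A ∪ B` with `|A Δ B| ≤ τ^{-Nₙ} δ^{β_{n,τ}/(8n)}` and
`|K \ A| + |K \ B| ≤ τ^{-Nₙ} δ^{β_{n,τ}/(8n³)}`, where `β_{n,τ} = τ/(16(n-1)|log τ|)`. -/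
theorem statement15 (n : ℕ) (hn : 2 ≤ n) (M : ℝ) (hM : 1 < M) :
    ∃ N : ℝ, 1 < N ∧
      ∀ (A B : Set (EuclideanSpace ℝ (Fin (n - 1)) × ℝ)) (τ t δ : ℝ),
        IsCompact A → IsCompact B → A = natSymm A → B = natSymm B →
        0 < τ → τ ≤ 1 / 2 → t ∈ Set.Icc τ (1 - τ) →
        volume (Prod.fst '' A) + volume (Prod.fst '' B) +
            (⨆ y, volume (hfiber A y)) + (⨆ y, volume (hfiber B y)) ≤
          ENNReal.ofReal (M / τ ^ (2 * n)) →
        |(volume A).toReal - 1| + |(volume B).toReal - 1| +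
          |(volume (t • A + (1 - t) • B)).toReal - 1| ≤ δ →
        δ ≤ Real.exp (-(τ ^ (-N))) →
        ∃ (v : EuclideanSpace ℝ (Fin (n - 1)) × ℝ)
          (K : Set (EuclideanSpace ℝ (Fin (n - 1)) × ℝ)),
          Convex ℝ K ∧ A ⊆ K ∧ (· + v) '' B ⊆ K ∧
          volume (symmDiff A ((· + v) '' B)) ≤
            ENNReal.ofReal (τ ^ (-N) *
              δ ^ (τ / (16 * ((n : ℝ) - 1) * |Real.log τ|) / (8 * (n : ℝ)))) ∧
          volume (K \ A) + volume (K \ ((· + v) '' B)) ≤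
            ENNReal.ofReal (τ ^ (-N) *
              δ ^ (τ / (16 * ((n : ℝ) - 1) * |Real.log τ|) / (8 * (n : ℝ) ^ 3))) := by
  obtain ⟨c, c1, hcore⟩ := core (n - 1) n (by omega) (by omega) M hM
  obtain ⟨m, hm⟩ := pow_unbounded_of_one_lt c (one_lt_two (α := ℝ))
  have n2 : (2 : ℝ) ≤ n := by exact_mod_cast hn
  refine ⟨((4 * n * (2 * n + 3 + m) : ℕ) : ℝ), ?_, ?_⟩
  · have : 1 < 4 * n * (2 * n + 3 + m) := by nlinarith
    exact_mod_cast this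
  intro A B τ t δ hA hB nA nB τ0 τ2 ht hL hδ hδN
  have dA := down_natSymm (by omega) hA nA
  have dB := down_natSymm (by omega) hB nB
  have hB0 : (fun p : EuclideanSpace ℝ (Fin (n - 1)) × ℝ => p + 0) '' B = B := by simp
  refine ⟨0, hullK A B, hullK_convex A B, subset_union_left.trans (subset_hullK A B), ?_⟩
  rw [hB0]
  refine ⟨subset_union_right.trans (subset_hullK A B), ?_⟩
  have hL1 : volume (Prod.fst '' A) ≤ ENNReal.ofReal (M / τ ^ (2 * n)) :=
    le_trans (le_trans le_self_add (le_trans le_self_add le_self_add)) hL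
  have hL2 : volume (hfiber A 0) ≤ ENNReal.ofReal (M / τ ^ (2 * n)) :=
    le_trans (le_trans (le_iSup (fun y => volume (hfiber A y)) 0)
      (le_trans le_add_self le_self_add)) hL
  have a1 : 0 ≤ |volume.real A - 1| := abs_nonneg _
  have a2 : 0 ≤ |volume.real B - 1| := abs_nonneg _
  have a3 : 0 ≤ |volume.real (t • A + (1 - t) • B) - 1| := abs_nonneg _
  have hδ : |volume.real A - 1| + |volume.real B - 1| +
    |volume.real (t • A + (1 - t) • B) - 1| ≤ δ := hδ
  have main : ∀ g : ℝ, 0 < g → c * g ≤ τ ^ (2 * n + 3) → δ ≤ g ^ (4 * n) →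
      volume (symmDiff A B) ≤ ENNReal.ofReal (c * g ^ n / τ ^ (2 * n + 3)) ∧
      volume (hullK A B \ A) + volume (hullK A B \ B) ≤
        ENNReal.ofReal (c * g / τ ^ (2 * n + 3)) := fun g g0 hg hgδ =>
    hcore A B τ t g hA hB dA dB τ0 τ2 ht.1 ht.2 hL1 hL2 g0 hg (by linarith) (by linarith)
      (by linarith)
  obtain ⟨b0, b1⟩ := beta_bounds hn τ0 τ2
  set β := τ / (16 * ((n : ℝ) - 1) * |Real.log τ|) with hβ
  have δ0 : 0 ≤ δ := by linarith
  have np : (0 : ℝ) < n := by linarith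
  have e1p : 0 < β / (8 * (n : ℝ)) := by positivity
  have e2p : 0 < β / (8 * (n : ℝ) ^ 3) := by positivity
  have e1le : β / (8 * (n : ℝ)) ≤ 1 / 4 := by
    rw [div_le_iff₀ (by positivity)]; nlinarith
  have e2le : β / (8 * (n : ℝ) ^ 3) ≤ 1 / (4 * n) := by
    rw [div_le_div_iff₀ (by positivity) (by positivity)]
    have : (n : ℝ) ≤ (n : ℝ) ^ 3 := le_self_pow₀ (by linarith) (by norm_num)
    nlinarith
  have P0 : 0 < τ ^ (2 * n + 3) := by positivity
  rcases eq_or_lt_of_le δ0 with hz | hpos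
  · -- vanishing deficit
    subst hz
    rw [Real.zero_rpow e1p.ne', Real.zero_rpow e2p.ne', mul_zero, ENNReal.ofReal_zero]
    have ev : ∀ᶠ g in nhdsWithin (0 : ℝ) (Ioi 0), 0 < g ∧ c * g ≤ τ ^ (2 * n + 3) := by
      have h1 : ∀ᶠ g in nhdsWithin (0 : ℝ) (Ioi 0), 0 < g := self_mem_nhdsWithin
      have h2 : Filter.Tendsto (fun g : ℝ => c * g) (nhdsWithin (0 : ℝ) (Ioi 0)) (nhds (c * 0)) :=
        ((continuous_const.mul continuous_id).tendsto 0).mono_left nhdsWithin_le_nhds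
      rw [mul_zero] at h2
      filter_upwards [h1, h2.eventually (ge_mem_nhds P0)] with g hg hg'
      exact ⟨hg, hg'⟩
    have lim : ∀ f : ℝ → ℝ, Continuous f → f 0 = 0 → Filter.Tendsto
        (fun g : ℝ => ENNReal.ofReal (f g)) (nhdsWithin (0 : ℝ) (Ioi 0)) (nhds 0) := by
      intro f hf h0
      have := ((ENNReal.continuous_ofReal.comp hf).tendsto 0).mono_left
        (nhdsWithin_le_nhds (s := Ioi 0))
      simpa [h0, Function.comp_def] using this
    constructor
    · refine ge_of_tendsto (lim (fun g => c * g ^ n / τ ^ (2 * n + 3)) (by fun_prop) ?_) ?_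
      · simp [zero_pow (show n ≠ 0 by omega)]
      · filter_upwards [ev] with g hg
        exact (main g hg.1 hg.2 (by have := hg.1; positivity)).1
    · refine ge_of_tendsto (lim (fun g => c * g / τ ^ (2 * n + 3)) (by fun_prop) (by simp)) ?_
      filter_upwards [ev] with g hg
      exact (main g hg.1 hg.2 (by have := hg.1; positivity)).2
  · -- positive deficit
    set p := 2 * n + 3 + m with hp
    have τN : τ ^ (-((4 * n * p : ℕ) : ℝ)) = (τ ^ (4 * n * p))⁻¹ := by
      rw [Real.rpow_neg τ0.le, Real.rpow_natCast]
    rw [τN] at hδN ⊢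
    have δN : δ ≤ τ ^ (4 * n * p) := by
      refine hδN.trans ?_
      rw [Real.exp_neg]
      have y0 : 0 < (τ ^ (4 * n * p))⁻¹ := by positivity
      have := Real.add_one_le_exp ((τ ^ (4 * n * p))⁻¹)
      calc _ ≤ ((τ ^ (4 * n * p))⁻¹)⁻¹ := inv_anti₀ y0 (by linarith)
        _ = _ := inv_inv _
    have δ1 : δ ≤ 1 := δN.trans (pow_le_one₀ τ0.le (by linarith))
    set g := δ ^ ((1 : ℝ) / (4 * n)) with hg
    have g0 : 0 < g := Real.rpow_pos_of_pos hpos _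
    have g4 : g ^ (4 * n) = δ := by
      rw [hg, ← Real.rpow_natCast, ← Real.rpow_mul δ0]
      push_cast
      rw [one_div_mul_cancel (by positivity), Real.rpow_one]
    have gn : g ^ n = δ ^ ((1 : ℝ) / 4) := by
      rw [hg, ← Real.rpow_natCast, ← Real.rpow_mul δ0]
      congr 1; field_simp
    have gp : g ≤ τ ^ p := by
      have : g ^ (4 * n) ≤ (τ ^ p) ^ (4 * n) := by
        rw [g4, ← pow_mul, mul_comm p]; exact δN
      exact le_of_pow_le_pow_left₀ (by omega) (by positivity) this
    have cτ : c * τ ^ m ≤ 1 := by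
      have : τ ^ m ≤ (1 / 2) ^ m := pow_le_pow_left₀ τ0.le τ2 m
      calc c * τ ^ m ≤ 2 ^ m * (1 / 2) ^ m := by gcongr
        _ = 1 := by rw [← mul_pow]; norm_num
    have hpe : τ ^ p = τ ^ m * τ ^ (2 * n + 3) := by rw [hp]; ring
    have cg : c * g ≤ τ ^ (2 * n + 3) := by
      calc c * g ≤ c * τ ^ p := by gcongr
        _ = (c * τ ^ m) * τ ^ (2 * n + 3) := by rw [hpe]; ring
        _ ≤ 1 * τ ^ (2 * n + 3) := by gcongr
        _ = _ := one_mul _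
    have cP : c / τ ^ (2 * n + 3) ≤ (τ ^ (4 * n * p))⁻¹ := by
      have q1 : τ ^ (4 * n * p) ≤ τ ^ p := pow_le_pow_of_le_one τ0.le (by linarith) (by nlinarith)
      rw [div_le_iff₀ P0, inv_mul_eq_div, le_div_iff₀ (by positivity)]
      calc c * τ ^ (4 * n * p) ≤ c * τ ^ p := by gcongr
        _ = (c * τ ^ m) * τ ^ (2 * n + 3) := by rw [hpe]; ring
        _ ≤ 1 * τ ^ (2 * n + 3) := by gcongr
        _ = _ := one_mul _
    obtain ⟨r1, r2⟩ := main g g0 cg g4.ge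
    refine ⟨r1.trans (ENNReal.ofReal_le_ofReal ?_), r2.trans (ENNReal.ofReal_le_ofReal ?_)⟩
    · rw [gn, mul_div_right_comm]
      gcongr ?_ * ?_
      exact Real.rpow_le_rpow_of_exponent_ge hpos δ1 e1le
    · rw [mul_div_right_comm]
      gcongr ?_ * ?_
      exact Real.rpow_le_rpow_of_exponent_ge hpos δ1 e2le
end

section
/- Let n ≥ 2 and M > 0. There exists a constant C, depending only on n and M, such that for all real numbers a, b with 0 ≤ a, b ≤ M and every t ∈ [0, 1]: (t a^{1/(n−1)} + (1 − t) b^{1/(n−1)})^{n−1} ≥ t a + (1 − t) b − C |a − b|^{2/(n−1)}. -/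
open Real

lemma aux_lip (L : ℝ) (hL : 0 ≤ L) (m : ℕ) : ∃ D : ℝ, 0 ≤ D ∧ ∀ x y : ℝ, 0 ≤ x → x ≤ L → 0 ≤ y → y ≤ L →
    (x - y) * (x ^ m - y ^ m) ≤ D * (x - y) ^ 2 := by
  induction m with
  | zero => exact ⟨0, le_rfl, fun x y _ _ _ _ => by simp⟩
  | succ m ih =>
    obtain ⟨D, hD, h⟩ := ih
    refine ⟨L * D + L ^ m, by positivity, fun x y hx hxL hy hyL => ?_⟩
    have h1 := mul_le_mul_of_nonneg_left (h x y hx hxL hy hyL) hx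
    have h2 : x * (D * (x - y) ^ 2) ≤ L * (D * (x - y) ^ 2) :=
      mul_le_mul_of_nonneg_right hxL (by positivity)
    have h3 : y ^ m * (x - y) ^ 2 ≤ L ^ m * (x - y) ^ 2 :=
      mul_le_mul_of_nonneg_right (pow_le_pow_left₀ hy hyL m) (by positivity)
    have h4 : (x - y) * (x ^ (m + 1) - y ^ (m + 1)) =
      x * ((x - y) * (x ^ m - y ^ m)) + y ^ m * (x - y) ^ 2 := by ring
    rw [h4]
    linarith

lemma aux_conv (L : ℝ) (hL : 0 ≤ L) (m : ℕ) : ∃ K : ℝ, 0 ≤ K ∧ ∀ x y t : ℝ, 0 ≤ x → x ≤ L → 0 ≤ y → y ≤ L →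
    0 ≤ t → t ≤ 1 →
    t * x ^ m + (1 - t) * y ^ m ≤ (t * x + (1 - t) * y) ^ m + K * (x - y) ^ 2 := by
  induction m with
  | zero => exact ⟨0, le_rfl, fun x y t _ _ _ _ _ _ => by simp⟩
  | succ m ih =>
    obtain ⟨K, hK, h⟩ := ih
    obtain ⟨D, hD, h'⟩ := aux_lip L hL m
    refine ⟨L * K + D, by positivity, fun x y t hx hxL hy hyL ht ht1 => ?_⟩
    have ht' : 0 ≤ 1 - t := by linarith
    have hz : 0 ≤ t * x + (1 - t) * y := by positivity
    have hzL : t * x + (1 - t) * y ≤ L := by nlinarith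
    have h1 := mul_le_mul_of_nonneg_left (h x y t hx hxL hy hyL ht ht1) hz
    have h2 : (t * x + (1 - t) * y) * (K * (x - y) ^ 2) ≤ L * (K * (x - y) ^ 2) :=
      mul_le_mul_of_nonneg_right hzL (by positivity)
    have h3 := mul_le_mul_of_nonneg_left (h' x y hx hxL hy hyL) (mul_nonneg ht ht')
    have h5 : t * (1 - t) * (D * (x - y) ^ 2) ≤ 1 * (D * (x - y) ^ 2) :=
      mul_le_mul_of_nonneg_right (by nlinarith) (by positivity)
    have h4 : t * x ^ (m + 1) + (1 - t) * y ^ (m + 1) =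
      (t * x + (1 - t) * y) * (t * x ^ m + (1 - t) * y ^ m) +
        t * (1 - t) * ((x - y) * (x ^ m - y ^ m)) := by ring
    rw [h4, pow_succ']
    linarith

lemma aux_sub {p a b : ℝ} (hp : 0 ≤ p) (hp1 : p ≤ 1) (ha : 0 ≤ a) (hb : 0 ≤ b) :
    |a ^ p - b ^ p| ≤ |a - b| ^ p := by
  wlog hab : b ≤ a generalizing a b
  · rw [abs_sub_comm, abs_sub_comm a b]
    exact this hb ha (by linarith)
  have h1 : b ^ p ≤ a ^ p := Real.rpow_le_rpow hb hab hp
  rw [abs_of_nonneg (by linarith), abs_of_nonneg (by linarith)]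
  have := Real.rpow_add_le_add_rpow (sub_nonneg.2 hab) hb hp hp1
  rw [sub_add_cancel] at this
  linarith

/-- elementary inequality \eqref{eq:ab conc}: for `0 ≤ a, b ≤ M` and
`t ∈ [0,1]`,
`(t a^{1/(n-1)} + (1-t) b^{1/(n-1)})^{n-1} ≥ t a + (1-t) b - C |a-b|^{2/(n-1)}`
with `C` depending only on `n` and `M`. -/
theorem statement16 (n : ℕ) (hn : 2 ≤ n) (M : ℝ) (hM : 0 < M) :
    ∃ C : ℝ, ∀ a b t : ℝ, 0 ≤ a → a ≤ M → 0 ≤ b → b ≤ M → t ∈ Set.Icc (0 : ℝ) 1 →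
      t * a + (1 - t) * b - C * |a - b| ^ (2 / ((n : ℝ) - 1)) ≤
        (t * a ^ (1 / ((n : ℝ) - 1)) + (1 - t) * b ^ (1 / ((n : ℝ) - 1))) ^ ((n : ℝ) - 1) := by
  obtain ⟨m, rfl⟩ : ∃ m, n = m + 1 := ⟨n - 1, by omega⟩
  have hm : m ≠ 0 := by omega
  have hm1 : (1 : ℝ) ≤ m := by exact_mod_cast (by omega : 1 ≤ m)
  have hc : ((m + 1 : ℕ) : ℝ) - 1 = m := by push_cast; ring
  rw [hc]
  obtain ⟨K, hK, h⟩ := aux_conv (M ^ (1 / (m : ℝ))) (by positivity) m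
  refine ⟨K, fun a b t ha haM hb hbM ht => ?_⟩
  have hp : 0 ≤ 1 / (m : ℝ) := by positivity
  have hp1 : 1 / (m : ℝ) ≤ 1 := by rw [div_le_one (by linarith)]; exact hm1
  have key := h (a ^ (1 / (m : ℝ))) (b ^ (1 / (m : ℝ))) t (by positivity)
    (Real.rpow_le_rpow ha haM hp) (by positivity) (Real.rpow_le_rpow hb hbM hp) ht.1 ht.2
  have hr : ∀ c : ℝ, 0 ≤ c → (c ^ (1 / (m : ℝ))) ^ m = c := fun c hc => by
    rw [one_div]; exact Real.rpow_inv_natCast_pow hc hm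
  rw [hr a ha, hr b hb] at key
  rw [Real.rpow_natCast]
  have hs := aux_sub hp hp1 ha hb
  have h2 : (a ^ (1 / (m : ℝ)) - b ^ (1 / (m : ℝ))) ^ 2 ≤ |a - b| ^ (2 / (m : ℝ)) := by
    have e : |a - b| ^ (2 / (m : ℝ)) = (|a - b| ^ (1 / (m : ℝ))) ^ 2 := by
      rw [← Real.rpow_mul_natCast (abs_nonneg _)]
      congr 1
      push_cast; ring
    rw [e, ← sq_abs]
    exact pow_le_pow_left₀ (abs_nonneg _) hs 2
  have h3 := mul_le_mul_of_nonneg_left h2 hK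
  linarith
end

section
/- Let n ≥ 2, let 0 < τ ≤ 1/2, t ∈ [τ, 1 − τ], and let K_A, K_B ⊆ ℝⁿ be convex sets, both having barycenter at the origin, contained in the ball B_R with R ≤ τ^{−N} for some constant N depending only on n, and with 1/2 ≤ |K_A|, |K_B| ≤ 2. Then there exists a constant C of the form C ≤ τ^{−N_n} (N_n depending only on n) such that, for every ζ > 0 with C ζ^{1/n} < 1 and every x ∈ (1 − Cζ^{1/n})(tK_A + (1 − t)K_B), one has |(x − tK_A) ∩ ((1 − t)K_B)| > ζ; equivalently, the convolution χ_{tK_A} ∗ χ_{(1−t)K_B} satisfies χ_{tK_A} ∗ χ_{(1−t)K_B}(x) > ζ at every such point x. -/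
open MeasureTheory Set Pointwise

/-- Volume of a slab inside a ball. -/
lemma slab_volume_le (n : ℕ) (hn : 2 ≤ n) (u : EuclideanSpace ℝ (Fin n)) (hu : ‖u‖ = 1)
    (r P : ℝ) (hr : 0 < r) (hP : 0 < P) (S : Set (EuclideanSpace ℝ (Fin n)))
    (hS1 : ∀ x ∈ S, ‖x‖ ≤ P) (hS2 : ∀ x ∈ S, |inner ℝ u x| ≤ r) :
    volume S ≤ ENNReal.ofReal (2 * r * (2 * P) ^ (n - 1)) := by
  have hn0 : 0 < n := by omega
  let i0 : Fin n := ⟨0, hn0⟩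
  have hv : Orthonormal ℝ (({i0} : Set (Fin n)).domRestrict (fun _ : Fin n => u)) := by
    constructor
    · intro i
      simpa using hu
    · intro i j hij
      exact absurd (Subsingleton.elim i j) hij
  obtain ⟨b, hb⟩ := hv.exists_orthonormalBasis_extension_of_card_eq (by simp)
  have hb0 : b i0 = u := hb i0 rfl
  let Q : Fin n → Set ℝ := fun i => if i = i0 then Icc (-r) r else Icc (-P) P
  have hQm : MeasurableSet (Set.univ.pi Q) := by
    refine MeasurableSet.univ_pi fun i => ?_
    by_cases h : i = i0 <;> simp [Q, h]
  have hmp := (PiLp.volume_preserving_ofLp (Fin n)).comp b.measurePreserving_repr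
  have hsub : S ⊆ (WithLp.ofLp ∘ b.repr) ⁻¹' (Set.univ.pi Q) := by
    intro x hx i _
    have hval : (WithLp.ofLp ∘ b.repr) x i = inner ℝ (b i) x := by
      simp [b.repr_apply_apply]
    rw [hval]
    by_cases h : i = i0
    · simp only [Q, h, if_true, hb0]
      exact abs_le.mp (hS2 x hx)
    · simp only [Q, h, if_false]
      refine abs_le.mp ((abs_real_inner_le_norm _ _).trans ?_)
      simpa using hS1 x hx
  calc volume S ≤ volume ((WithLp.ofLp ∘ b.repr) ⁻¹' (Set.univ.pi Q)) := measure_mono hsub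
    _ = volume (Set.univ.pi Q) := hmp.measure_preimage hQm.nullMeasurableSet
    _ = ∏ i, volume (Q i) := volume_pi_pi _
    _ = volume (Q i0) * ∏ i ∈ Finset.univ.erase i0, volume (Q i) :=
        (Finset.mul_prod_erase _ _ (Finset.mem_univ _)).symm
    _ = ENNReal.ofReal (2 * r) * ∏ i ∈ Finset.univ.erase i0, ENNReal.ofReal (2 * P) := by
        congr 1
        · simp only [Q, if_true, Real.volume_Icc]
          ring_nf
        · refine Finset.prod_congr rfl fun i hi => ?_
          simp only [Q, Finset.ne_of_mem_erase hi, if_false, Real.volume_Icc]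
          ring_nf
    _ = ENNReal.ofReal (2 * r * (2 * P) ^ (n - 1)) := by
        rw [Finset.prod_const, Finset.card_erase_of_mem (Finset.mem_univ _), Finset.card_univ,
          Fintype.card_fin, ← ENNReal.ofReal_pow (by positivity),
          ← ENNReal.ofReal_mul (by positivity)]

/-- A convex set of large volume with barycenter at the origin contains a definite ball. -/
lemma ball_subset_of_barycenter (n : ℕ) (hn : 2 ≤ n) (K : Set (EuclideanSpace ℝ (Fin n)))
    (hK : Convex ℝ K) (hbar : (∫ x in K, x) = 0) (P r : ℝ) (hP : 0 < P) (hr : 0 < r)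
    (hKP : K ⊆ Metric.closedBall 0 P) (hvol : ENNReal.ofReal (1 / 2) ≤ volume K)
    (hrP : 2 * r * (2 * P) ^ (n - 1) ≤ 1 / 8) : Metric.ball 0 r ⊆ K := by
  have hfr : volume (frontier K) = 0 := hK.addHaar_frontier volume
  have hae := interior_ae_eq_of_null_frontier hfr
  set U := interior K with hU
  have hUo : IsOpen U := isOpen_interior
  have hUbar : (∫ x in U, x) = 0 := by rw [setIntegral_congr_set hae, hbar]
  have hUvol : ENNReal.ofReal (1 / 2) ≤ volume U := by rwa [measure_congr hae]
  have hUP : ∀ x ∈ U, ‖x‖ ≤ P := fun x hx => by simpa using hKP (interior_subset hx)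
  have hUfin : volume U ≠ ⊤ := by
    refine ((measure_mono (interior_subset.trans hKP)).trans_lt ?_).ne
    exact measure_closedBall_lt_top
  have hUreal : 1 / 2 ≤ volume.real U :=
    (ENNReal.ofReal_le_iff_le_toReal hUfin).mp hUvol
  intro v hv
  by_contra hvK
  have hvU : v ∉ U := fun h => hvK (interior_subset h)
  obtain ⟨f, hf⟩ := geometric_hahn_banach_open_point hK.interior hUo hvU
  obtain ⟨w, hw⟩ : ∃ w : EuclideanSpace ℝ (Fin n), ∀ x, inner ℝ w x = f x :=
    ⟨(InnerProductSpace.toDual ℝ _).symm f, fun x => InnerProductSpace.toDual_symm_apply⟩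
  have hne : U.Nonempty := by
    rw [nonempty_iff_ne_empty]
    intro h
    rw [h] at hUreal
    norm_num at hUreal
  have hw0 : w ≠ 0 := by
    rintro rfl
    obtain ⟨y, hy⟩ := hne
    have := hf y hy
    rw [← hw, ← hw] at this
    simp at this
  have hwn : 0 < ‖w‖ := norm_pos_iff.mpr hw0
  set u := (‖w‖⁻¹ : ℝ) • w with hu
  have hun : ‖u‖ = 1 := by
    rw [hu, norm_smul, norm_inv, norm_norm, inv_mul_cancel₀ hwn.ne']
  have hle : ∀ x ∈ U, inner ℝ u x < r := by
    intro x hx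
    have h1 : inner ℝ u x < inner ℝ u v := by
      rw [hu, real_inner_smul_left, real_inner_smul_left, hw, hw]
      exact mul_lt_mul_of_pos_left (hf x hx) (inv_pos.mpr hwn)
    have h2 : inner ℝ u v ≤ ‖u‖ * ‖v‖ := real_inner_le_norm _ _
    rw [hun, one_mul] at h2
    have h3 : ‖v‖ < r := by simpa using hv
    linarith
  have hint : IntegrableOn (fun x : EuclideanSpace ℝ (Fin n) => x) U volume := by
    refine Measure.integrableOn_of_bounded hUfin (by fun_prop) (M := P) ?_
    exact (ae_restrict_iff' hUo.measurableSet).mpr (Filter.Eventually.of_forall hUP)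
  have hinti : IntegrableOn (fun x : EuclideanSpace ℝ (Fin n) => inner ℝ u x) U volume :=
    Integrable.const_inner u hint
  have hint0 : ∫ x in U, inner ℝ u x = 0 := by
    rw [integral_inner hint, hUbar, inner_zero_right]
  have hconst : IntegrableOn (fun _ : EuclideanSpace ℝ (Fin n) => r) U volume :=
    integrableOn_const hUfin
  have hI : ∫ x in U, (r - inner ℝ u x) = r * volume.real U := by
    rw [integral_sub hconst hinti, hint0, setIntegral_const, smul_eq_mul]
    ring
  have hmk := mul_meas_ge_le_integral_of_nonneg (μ := volume.restrict U)
    (f := fun x => r - inner ℝ u x)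
    ((ae_restrict_iff' hUo.measurableSet).mpr
      (Filter.Eventually.of_forall fun x hx => by
        have := hle x hx
        simp only [Pi.zero_apply]
        linarith))
    (hconst.sub hinti) (2 * r)
  rw [hI] at hmk
  set T := {x : EuclideanSpace ℝ (Fin n) | 2 * r ≤ r - inner ℝ u x} with hT
  have hTm : MeasurableSet T := by
    refine measurableSet_le measurable_const ?_
    fun_prop
  rw [measureReal_restrict_apply hTm] at hmk
  have hS : volume.real (U \ T) ≤ 1 / 8 := by
    refine ENNReal.toReal_le_of_le_ofReal (by norm_num) ?_
    refine (slab_volume_le n hn u hun r P hr hP _ (fun x hx => hUP x hx.1) ?_).trans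
      (ENNReal.ofReal_le_ofReal hrP)
    rintro x ⟨hx, hxT⟩
    have h1 := hle x hx
    have h2 : r - inner ℝ u x < 2 * r := not_le.mp hxT
    rw [abs_le]
    constructor <;> linarith
  have hsplit := measureReal_inter_add_sdiff (μ := volume) (s := U) hTm hUfin
  rw [inter_comm] at hsplit
  have : 2 * volume.real (T ∩ U) ≤ volume.real U := by
    have h : r * (2 * volume.real (T ∩ U)) ≤ r * volume.real U := by linarith
    exact le_of_mul_le_mul_left h hr
  linarith

/-- Scaling and convexity. -/
lemma smul_mem_of_ball {n : ℕ} (K : Set (EuclideanSpace ℝ (Fin n))) (hK : Convex ℝ K)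
    (r τ s δ : ℝ) (hr : 0 < r) (hτ : 0 < τ) (hs : τ ≤ s) (hδ : 0 < δ) (hδ1 : δ < 1)
    (hball : Metric.ball 0 r ⊆ K) (a w : EuclideanSpace ℝ (Fin n)) (ha : a ∈ K)
    (hw : ‖w‖ < δ * τ * r) : (1 - δ) • s • a + w ∈ s • K := by
  have hs0 : 0 < s := hτ.trans_le hs
  have hmem : (δ * s)⁻¹ • w ∈ K := by
    apply hball
    rw [mem_ball_zero_iff, norm_smul, Real.norm_of_nonneg (by positivity),
      inv_mul_lt_iff₀ (by positivity)]
    refine hw.trans_le ?_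
    gcongr
  refine ⟨(1 - δ) • a + δ • (δ * s)⁻¹ • w,
    hK ha hmem (by linarith) hδ.le (by ring), ?_⟩
  simp only [smul_add, smul_smul]
  congr 1
  · congr 1
    ring
  · have : s * (δ * (δ * s)⁻¹) = 1 := by field_simp
    rw [this, one_smul]

/-- claim \eqref{eq:chi KAKB} in the proof of Proposition `coS`: if
`K_A, K_B ⊆ B_R` are convex sets with barycenter at the origin,
`1/2 ≤ |K_A|, |K_B| ≤ 2` and `R ≤ τ^{-N}`, then there is a constant `C ≤ τ^{-Nₙ}` such
that for every `ζ > 0` with `C ζ^{1/n} < 1` and every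
`x ∈ (1 - C ζ^{1/n})(tK_A + (1-t)K_B)` one has `|(x - tK_A) ∩ (1-t)K_B| > ζ`, i.e. the
convolution `χ_{tK_A} ∗ χ_{(1-t)K_B}` exceeds `ζ` at `x`. -/
theorem statement17 (n : ℕ) (hn : 2 ≤ n) (N : ℝ) :
    ∃ Nn : ℝ, ∀ (τ t R : ℝ) (K_A K_B : Set (EuclideanSpace ℝ (Fin n))),
      0 < τ → τ ≤ 1 / 2 → t ∈ Set.Icc τ (1 - τ) →
      Convex ℝ K_A → Convex ℝ K_B →
      (∫ x in K_A, x) = 0 → (∫ x in K_B, x) = 0 →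
      K_A ⊆ Metric.closedBall 0 R → K_B ⊆ Metric.closedBall 0 R → R ≤ τ ^ (-N) →
      ENNReal.ofReal (1 / 2) ≤ volume K_A → volume K_A ≤ 2 →
      ENNReal.ofReal (1 / 2) ≤ volume K_B → volume K_B ≤ 2 →
      ∃ C : ℝ, 0 < C ∧ C ≤ τ ^ (-Nn) ∧
        ∀ (ζ : ℝ) (x : EuclideanSpace ℝ (Fin n)),
          0 < ζ → C * ζ ^ (1 / (n : ℝ)) < 1 →
          x ∈ (1 - C * ζ ^ (1 / (n : ℝ))) • (t • K_A + (1 - t) • K_B) →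
          ENNReal.ofReal ζ <
            volume ((({x} : Set (EuclideanSpace ℝ (Fin n))) - t • K_A) ∩ ((1 - t) • K_B)) ∧
          ζ < ∫ z, Set.indicator (t • K_A) (fun _ => (1 : ℝ)) (x - z) *
                Set.indicator ((1 - t) • K_B) (fun _ => (1 : ℝ)) z := by
  have hn0 : 0 < n := by omega
  haveI : Nonempty (Fin n) := ⟨⟨0, hn0⟩⟩
  set ω : ℝ := volume.real (Metric.ball (0 : EuclideanSpace ℝ (Fin n)) 1) with hω
  have hω0 : 0 < ω := by
    refine ENNReal.toReal_pos ?_ measure_ball_lt_top.ne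
    exact (Metric.measure_ball_pos volume _ one_pos).ne'
  set A : ℝ := 1 + 1 / ω with hA
  have hA1 : 1 ≤ A := by
    have : 0 < 1 / ω := by positivity
    linarith
  have hAω : 1 < A ^ n * ω := by
    have h1 : A ≤ A ^ n := le_self_pow₀ hA1 hn0.ne'
    have h2 : A * ω = ω + 1 := by
      rw [hA]
      field_simp
    nlinarith
  obtain ⟨k, hk⟩ := pow_unbounded_of_one_lt (A * 2 ^ (n + 3)) (one_lt_two : (1 : ℝ) < 2)
  refine ⟨k + 1 + N * (n - 1 : ℕ), ?_⟩
  intro τ t R K_A K_B hτ hτ2 ht hKA hKB hbA hbB hAR hBR hR hA1' _ hB1' _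
  set P : ℝ := τ ^ (-N) with hPdef
  have hP : 0 < P := Real.rpow_pos_of_pos hτ _
  have hAP : K_A ⊆ Metric.closedBall 0 P := hAR.trans (Metric.closedBall_subset_closedBall hR)
  have hBP : K_B ⊆ Metric.closedBall 0 P := hBR.trans (Metric.closedBall_subset_closedBall hR)
  set r : ℝ := 1 / (16 * (2 * P) ^ (n - 1)) with hrdef
  have hr : 0 < r := by positivity
  have hrP : 2 * r * (2 * P) ^ (n - 1) ≤ 1 / 8 := by
    apply le_of_eq
    rw [hrdef]
    field_simp
    norm_num
  have hballA := ball_subset_of_barycenter n hn K_A hKA hbA P r hP hr hAP hA1' hrP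
  have hballB := ball_subset_of_barycenter n hn K_B hKB hbB P r hP hr hBP hB1' hrP
  have hA0 : 0 < A := by linarith
  refine ⟨A / (τ * r), by positivity, ?_, ?_⟩
  · have e1 : A / (τ * r) = (A * 2 ^ (n + 3)) * (τ⁻¹ * P ^ (n - 1)) := by
      have : n + 3 = (n - 1) + 4 := by omega
      rw [hrdef, this, mul_pow, pow_add]
      field_simp
      norm_num
    have e2 : τ ^ (-((k : ℝ) + 1 + N * (n - 1 : ℕ))) = (τ⁻¹) ^ k * (τ⁻¹ * P ^ (n - 1)) := by
      rw [hPdef, ← Real.rpow_natCast (τ ^ (-N)), ← Real.rpow_mul hτ.le, ← Real.rpow_neg_one τ,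
        ← Real.rpow_natCast (τ ^ (-1 : ℝ)) k, ← Real.rpow_mul hτ.le, ← Real.rpow_add hτ,
        ← Real.rpow_add hτ]
      congr 1
      ring
    rw [e1, e2]
    gcongr
    refine hk.le.trans ?_
    gcongr
    rw [le_inv_comm₀ (by norm_num) hτ]
    linarith
  · intro ζ x hζ hC hx
    set C : ℝ := A / (τ * r) with hCdef
    have hC0 : 0 < C := by positivity
    set δ : ℝ := C * ζ ^ (1 / (n : ℝ)) with hδdef
    have hζr : 0 < ζ ^ (1 / (n : ℝ)) := Real.rpow_pos_of_pos hζ _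
    have hδ : 0 < δ := by positivity
    obtain ⟨y, ⟨p, ⟨a, ha, rfl⟩, q, ⟨b, hb, rfl⟩, rfl⟩, rfl⟩ := hx
    simp only [] at *
    set x := (1 - δ) • (t • a + (1 - t) • b) with hxdef
    set T := (({x} : Set (EuclideanSpace ℝ (Fin n))) - t • K_A) ∩ ((1 - t) • K_B) with hT
    have hmemT : ∀ z, z ∈ T ↔ (x - z ∈ t • K_A ∧ z ∈ (1 - t) • K_B) := by
      intro z
      rw [hT, mem_inter_iff]
      refine and_congr_left fun _ => ?_
      rw [singleton_sub]
      constructor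
      · rintro ⟨y, hy, rfl⟩
        simpa using hy
      · intro h
        exact ⟨x - z, h, by simp⟩
    have hsub : Metric.ball ((1 - δ) • (1 - t) • b) (δ * τ * r) ⊆ T := by
      intro z hz
      rw [mem_ball_iff_norm] at hz
      rw [hmemT]
      constructor
      · have := smul_mem_of_ball K_A hKA r τ t δ hr hτ ht.1 hδ hC hballA a
          (-(z - (1 - δ) • (1 - t) • b)) ha (by rwa [norm_neg])
        convert this using 1
        rw [hxdef, smul_add]
        abel
      · have := smul_mem_of_ball K_B hKB r τ (1 - t) δ hr hτ (by linarith [ht.2]) hδ hC hballB b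
          (z - (1 - δ) • (1 - t) • b) hb hz
        convert this using 1
        abel
    have hvol : ENNReal.ofReal ζ < volume T := by
      refine lt_of_lt_of_le ?_ (measure_mono hsub)
      rw [Measure.addHaar_ball _ _ (by positivity), finrank_euclideanSpace_fin,
        ← ENNReal.ofReal_toReal (measure_ball_lt_top
          (μ := (volume : Measure (EuclideanSpace ℝ (Fin n)))) (x := 0) (r := 1)).ne,
        ← ENNReal.ofReal_mul (by positivity)]
      have e : δ * τ * r = A * ζ ^ (1 / (n : ℝ)) := by
        rw [hδdef, hCdef]
        field_simp
      have e3 : (ζ ^ (1 / (n : ℝ))) ^ n = ζ := by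
        rw [one_div]
        exact Real.rpow_inv_natCast_pow hζ.le hn0.ne'
      have key : ζ < (δ * τ * r) ^ n * ω := by
        rw [e, mul_pow, e3]
        nlinarith
      exact (ENNReal.ofReal_lt_ofReal_iff (by positivity)).mpr key
    refine ⟨hvol, ?_⟩
    have hTconv : Convex ℝ T :=
      ((convex_singleton x).sub (hKA.smul t)).inter (hKB.smul (1 - t))
    have hTfin : volume T ≠ ⊤ := by
      have hb : Bornology.IsBounded T :=
        ((Metric.isBounded_closedBall.subset hBP).smul₀ (1 - t)).subset inter_subset_right
      exact hb.measure_lt_top.ne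
    have hfun : (fun z => Set.indicator (t • K_A) (fun _ => (1 : ℝ)) (x - z) *
                Set.indicator ((1 - t) • K_B) (fun _ => (1 : ℝ)) z)
        = T.indicator (fun _ => (1 : ℝ)) := by
      funext z
      by_cases h1 : x - z ∈ t • K_A <;> by_cases h2 : z ∈ (1 - t) • K_B <;>
        simp [Set.indicator, hmemT, h1, h2]
    rw [hfun, integral_indicator₀ (hTconv.nullMeasurableSet volume), setIntegral_const,
      smul_eq_mul, mul_one]
    exact (ENNReal.ofReal_lt_iff_lt_toReal hζ.le hTfin).mp hvol
end
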